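/- arXiv:2210.04444 — 3 statements merged into one kernel-verified Lean document; each statement's English description precedes it below -/
import Mathlib

section
/- Let 0 < p ≤ 1, let ω be a weight on ℤ, let A be a unital Banach algebra with unit e, and let f : ℤ → A satisfy ∑_{n∈ℤ} ‖f(n)‖^p ω(n)^p < ∞. If f̂(z) := ∑_{n∈ℤ} f(n) zⁿ is invertible in A for every z ∈ 𝕋 = {z ∈ ℂ : |z| = 1}, then there exist a weight ν on ℤ with 1 ≤ ν(n) ≤ ω(n) for all n ∈ ℤ, with ν constant if and only if ω is constant, and a function g : ℤ → A with ∑_{n∈ℤ} ‖g(n)‖^p ν(n)^p < ∞ such that (f ⋆ g)(n) = (g ⋆ f)(n) = δ₀(n) for all n ∈ ℤ, where δ₀(0) = e and δ₀(n) = 0 for n ≠ 0. In particular, if ω is admissible, then g can be taken with ∑_{n∈ℤ} ‖g(n)‖^p ω(n)^p < ∞. -/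
open scoped BigOperators

/-- A weight on `ℤ`: `ω : ℤ → [1,∞)` with `ω(m+n) ≤ ω(m)ω(n)`. -/
def IsWeight (ω : ℤ → ℝ) : Prop :=
  (∀ n, 1 ≤ ω n) ∧ ∀ m n, ω (m + n) ≤ ω m * ω n

/-- `ρ₁(ω) = sup{ω(-n)^{-1/n} : n ∈ ℕ, n ≥ 1}`. -/
noncomputable def rho1 (ω : ℤ → ℝ) : ℝ :=
  sSup {x : ℝ | ∃ n : ℕ, 0 < n ∧ x = ω (-(n : ℤ)) ^ (-(1 : ℝ) / (n : ℝ))}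

/-- `ρ₂(ω) = inf{ω(n)^{1/n} : n ∈ ℕ, n ≥ 1}`. -/
noncomputable def rho2 (ω : ℤ → ℝ) : ℝ :=
  sInf {x : ℝ | ∃ n : ℕ, 0 < n ∧ x = ω (n : ℤ) ^ ((1 : ℝ) / (n : ℝ))}

/-- A weight is admissible if `ρ₁(ω) = ρ₂(ω) = 1`. -/
def IsAdmissible (ω : ℤ → ℝ) : Prop := rho1 ω = 1 ∧ rho2 ω = 1

section WienerAux
open scoped ENNReal
open Filter Topology

def wlListEquiv : Unit ⊕ (ℤ × List ℤ) ≃ List ℤ where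
  toFun x := match x with
    | Sum.inl _ => []
    | Sum.inr (k, l) => k :: l
  invFun l := match l with
    | [] => Sum.inl ()
    | k :: l => Sum.inr (k, l)
  left_inv x := by rcases x with _ | ⟨k, l⟩ <;> rfl
  right_inv l := by cases l <;> rfl

theorem wl_ennreal_tsum_list (F : List ℤ → ℝ≥0∞) :
    ∑' l, F l = F [] + ∑' k, ∑' l, F (k :: l) := by
  rw [← wlListEquiv.tsum_eq, Summable.tsum_sum ENNReal.summable ENNReal.summable,
    ← ENNReal.tsum_prod]
  simp [wlListEquiv]

theorem wl_list_le (a : ℤ → ℝ≥0∞) (ha : ∑' k, a k < 1) :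
    ∑' l : List ℤ, (l.map a).prod ≤ (1 - ∑' k, a k)⁻¹ := by
  set s := ∑' k, a k with hs
  have hne : (1 - s) ≠ 0 := by simpa using (tsub_pos_of_lt ha).ne'
  have hnt : (1 - s) ≠ ⊤ := ne_top_of_le_ne_top ENNReal.one_ne_top tsub_le_self
  have hS : ∀ N : ℕ, ∑' l : List ℤ, (if l.length < N then (l.map a).prod else 0) ≤ (1 - s)⁻¹ := by
    intro N
    induction N with
    | zero => simp
    | succ N ih =>
      rw [wl_ennreal_tsum_list]
      have h1 : ∀ k : ℤ, ∑' l : List ℤ, (if (k :: l).length < N + 1 then ((k :: l).map a).prod else 0)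
          = a k * ∑' l : List ℤ, (if l.length < N then (l.map a).prod else 0) := by
        intro k
        rw [← ENNReal.tsum_mul_left]
        congr 1; ext l
        simp
      simp_rw [h1]
      rw [ENNReal.tsum_mul_right, ← hs]
      calc _ ≤ 1 + s * (1 - s)⁻¹ := by
            gcongr
            simp
        _ = (1 - s) * (1 - s)⁻¹ + s * (1 - s)⁻¹ := by rw [ENNReal.mul_inv_cancel hne hnt]
        _ = (1 - s)⁻¹ := by rw [← add_mul, tsub_add_cancel_of_le ha.le, one_mul]
  rw [ENNReal.tsum_eq_iSup_sum]
  refine iSup_le fun t => ?_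
  refine le_trans ?_ (hS (t.sup List.length + 1))
  refine le_trans (Finset.sum_le_sum (g := fun l : List ℤ => if l.length < t.sup List.length + 1 then (l.map a).prod else 0) ?_) (ENNReal.sum_le_tsum t)
  intro l hl
  have : l.length ≤ t.sup List.length := Finset.le_sup (f := List.length) hl
  simp [Nat.lt_succ_of_le this]

theorem wl_rpow_sum_le {ι : Type*} (s : Finset ι) (x : ι → ℝ≥0∞) {p : ℝ} (hp0 : 0 < p) (hp1 : p ≤ 1) :
    (∑ i ∈ s, x i) ^ p ≤ ∑ i ∈ s, x i ^ p := by
  classical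
  induction s using Finset.induction_on with
  | empty => simp [hp0]
  | insert i s hi ih =>
    rw [Finset.sum_insert hi, Finset.sum_insert hi]
    exact (ENNReal.rpow_add_le_add_rpow _ _ hp0.le hp1).trans (by gcongr)

theorem wl_rpow_tsum_le {ι : Type*} (x : ι → ℝ≥0∞) {p : ℝ} (hp0 : 0 < p) (hp1 : p ≤ 1) :
    (∑' i, x i) ^ p ≤ ∑' i, x i ^ p := by
  rw [← ENNReal.le_rpow_inv_iff hp0, ENNReal.tsum_eq_iSup_sum]
  refine iSup_le fun t => ?_
  rw [ENNReal.le_rpow_inv_iff hp0]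
  exact (wl_rpow_sum_le t x hp0 hp1).trans (ENNReal.sum_le_tsum t)

theorem wl_core_ennreal (a b ν G : ℤ → ℝ≥0∞) {p : ℝ} (hp0 : 0 < p) (hp1 : p ≤ 1)
    (hν : ∀ m n, ν (m + n) ≤ ν m * ν n)
    (hG : ∀ n, G n ≤ ∑' l : List ℤ, (l.map a).prod * b (n - l.sum))
    (ha : ∑' k, (a k * ν k) ^ p < 1) (hb : ∑' n, (b n * ν n) ^ p ≠ ⊤) :
    ∑' n, (G n * ν n) ^ p ≠ ⊤ := by
  have hl : ∀ (l : List ℤ) (n : ℤ), (l.map a).prod * b (n - l.sum) * ν n ≤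
      (l.map fun k => a k * ν k).prod * (b (n - l.sum) * ν (n - l.sum)) := by
    intro l
    induction l with
    | nil => intro n; simp
    | cons k l ih =>
      intro n
      have h1 := ih (n - k)
      have h2 := hν k (n - k)
      have e : n - k - l.sum = n - (k :: l).sum := by simp; ring
      rw [e] at h1
      simp only [add_sub_cancel] at h2
      simp only [List.map_cons, List.prod_cons]
      calc _ ≤ a k * (l.map a).prod * b (n - (k :: l).sum) * (ν k * ν (n - k)) := by gcongr
        _ = a k * ν k * ((l.map a).prod * b (n - (k :: l).sum) * ν (n - k)) := by ring
        _ ≤ a k * ν k * ((l.map fun k => a k * ν k).prod * (b (n - (k :: l).sum) *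
              ν (n - (k :: l).sum))) := by gcongr
        _ = _ := by ring
  have hpow : ∀ l : List ℤ, (l.map fun k => a k * ν k).prod ^ p = (l.map fun k => (a k * ν k) ^ p).prod := by
    intro l
    induction l with
    | nil => simp
    | cons k l ih => simp [ENNReal.mul_rpow_of_nonneg _ _ hp0.le] at ih ⊢; rw [← ih]
  have key : ∑' n, (G n * ν n) ^ p ≤
      (∑' l : List ℤ, (l.map fun k => (a k * ν k) ^ p).prod) * ∑' n, (b n * ν n) ^ p := by
    calc _ ≤ ∑' n, ∑' l : List ℤ, (l.map fun k => (a k * ν k) ^ p).prod *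
              (b (n - l.sum) * ν (n - l.sum)) ^ p := by
          refine ENNReal.tsum_le_tsum fun n => ?_
          calc _ ≤ (∑' l : List ℤ, (l.map fun k => a k * ν k).prod * (b (n - l.sum) * ν (n - l.sum))) ^ p := by
                refine ENNReal.rpow_le_rpow ?_ hp0.le
                refine (mul_le_mul_left (hG n) _).trans ?_
                rw [← ENNReal.tsum_mul_right]
                exact ENNReal.tsum_le_tsum fun l => hl l n
            _ ≤ _ := by
                refine (wl_rpow_tsum_le _ hp0 hp1).trans (ENNReal.tsum_le_tsum fun l => ?_)
                rw [ENNReal.mul_rpow_of_nonneg _ _ hp0.le, hpow]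
      _ = ∑' l : List ℤ, (l.map fun k => (a k * ν k) ^ p).prod * ∑' n, (b n * ν n) ^ p := by
          rw [ENNReal.tsum_comm]
          congr 1; ext l
          rw [ENNReal.tsum_mul_left]
          congr 1
          exact (Equiv.subRight l.sum).tsum_eq (fun n => (b n * ν n) ^ p)
      _ = _ := ENNReal.tsum_mul_right
  refine ne_top_of_le_ne_top (ENNReal.mul_ne_top ?_ hb) key
  refine ne_top_of_le_ne_top ?_ (wl_list_le _ ha)
  simpa using (tsub_pos_of_lt ha).ne'

theorem wl_summable_list (a : ℤ → ℝ) (ha0 : ∀ k, 0 ≤ a k) (ha : Summable a) (ha1 : ∑' k, a k < 1) :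
    Summable fun l : List ℤ => (l.map a).prod := by
  have h1 : ∑' k, ENNReal.ofReal (a k) < 1 := by
    rw [← ENNReal.ofReal_tsum_of_nonneg ha0 ha]
    simpa using ha1
  have h2 := wl_list_le _ h1
  have h3 : ∀ l : List ℤ, 0 ≤ (l.map a).prod := fun l => List.prod_nonneg (by simpa using fun k _ => ha0 k)
  have h4 : ∀ l : List ℤ, (l.map fun k => ENNReal.ofReal (a k)).prod = ENNReal.ofReal (l.map a).prod := by
    intro l
    induction l with
    | nil => simp
    | cons k l ih => simp only [List.map_cons, List.prod_cons, ih, ENNReal.ofReal_mul (ha0 k)]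
  simp_rw [h4] at h2
  have h5 : ∑' l : List ℤ, ENNReal.ofReal (l.map a).prod ≠ ⊤ := by
    refine ne_top_of_le_ne_top ?_ h2
    simpa using (tsub_pos_of_lt h1).ne'
  have := ENNReal.summable_toReal h5
  refine this.congr fun l => ?_
  rw [ENNReal.toReal_ofReal (h3 l)]

theorem wl_circle_hasSum {A : Type*} [NormedRing A] [NormedAlgebra ℂ A] [CompleteSpace A]
    {ι : Type*} [Countable ι] (φ : ι → ℂ → A) (u : ι → ℝ) (hu : Summable u)
    (hc : ∀ i, ContinuousOn (φ i) (Metric.sphere 0 1))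
    (hb : ∀ i, ∀ z : ℂ, ‖z‖ = 1 → ‖φ i z‖ ≤ u i) :
    HasSum (fun i => ∮ z in C(0, 1), φ i z) (∮ z in C(0, 1), ∑' i, φ i z) := by
  have hm : ∀ θ : ℝ, ‖circleMap 0 1 θ‖ = 1 := by intro θ; simp
  unfold circleIntegral
  refine intervalIntegral.hasSum_integral_of_dominated_convergence (fun i _ => u i) ?_ ?_ ?_ ?_ ?_
  · intro i
    refine Continuous.aestronglyMeasurable ?_
    simp only [deriv_circleMap]
    refine ((continuous_circleMap 0 1).mul continuous_const).smul ?_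
    exact (hc i).comp_continuous (continuous_circleMap 0 1) (fun θ => by simp)
  · intro i
    refine Eventually.of_forall fun θ _ => ?_
    rw [norm_smul]
    simpa using hb i _ (hm θ)
  · exact Eventually.of_forall fun θ _ => hu
  · exact intervalIntegrable_const
  · refine Eventually.of_forall fun θ _ => ?_
    refine HasSum.const_smul _ ?_
    exact (Summable.of_norm_bounded hu fun i => hb i _ (hm θ)).hasSum

theorem wl_circle_clm {A : Type*} [NormedRing A] [NormedAlgebra ℂ A] [CompleteSpace A]
    (L : A →L[ℂ] A) (F : ℂ → A) (hF : ContinuousOn F (Metric.sphere 0 1)) :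
    (∮ z in C(0, 1), L (F z)) = L (∮ z in C(0, 1), F z) := by
  unfold circleIntegral
  rw [← ContinuousLinearMap.intervalIntegral_comp_comm]
  · simp
  · refine Continuous.intervalIntegrable ?_ _ _
    simp only [deriv_circleMap]
    refine ((continuous_circleMap 0 1).mul continuous_const).smul ?_
    exact hF.comp_continuous (continuous_circleMap 0 1) (fun θ => by simp)

noncomputable def wlCoef {A : Type*} [NormedRing A] [NormedAlgebra ℂ A] (F : ℂ → A) (n : ℤ) : A :=
  (2 * (Real.pi : ℂ) * Complex.I)⁻¹ • ∮ z in C(0, 1), z ^ (-n - 1) • F z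

theorem wl_coef_one {A : Type*} [NormedRing A] [NormedAlgebra ℂ A] [CompleteSpace A] (n : ℤ) :
    wlCoef (fun _ => (1 : A)) n = if n = 0 then 1 else 0 := by
  unfold wlCoef
  rw [circleIntegral.integral_smul_const]
  split_ifs with h
  · subst h
    have := circleIntegral.integral_sub_center_inv 0 (R := 1) one_ne_zero
    simp only [sub_zero] at this
    simp only [neg_zero, zero_sub, zpow_neg_one, this]
    rw [smul_smul, inv_mul_cancel₀ Complex.two_pi_I_ne_zero, one_smul]
  · have := circleIntegral.integral_sub_zpow_of_ne (n := -n - 1) (by omega) 0 0 1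
    simp only [sub_zero] at this
    simp [this]

theorem wl_norm_ne {z : ℂ} (hz : ‖z‖ = 1) : z ≠ 0 := by
  rintro rfl; simp at hz

theorem wl_zpow_cont (n : ℤ) : ContinuousOn (fun z : ℂ => z ^ n) (Metric.sphere 0 1) := by
  intro z hz
  exact (continuousAt_zpow₀ z n (Or.inl (wl_norm_ne (by simpa using hz)))).continuousWithinAt

theorem wl_coef_bound {A : Type*} [NormedRing A] [NormedAlgebra ℂ A] [CompleteSpace A]
    {R B : ℝ} (hR : 1 < R) (F : ℂ → A)
    (hd : ∀ z : ℂ, R⁻¹ ≤ ‖z‖ → ‖z‖ ≤ R → DifferentiableAt ℂ F z)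
    (hB : ∀ z : ℂ, R⁻¹ ≤ ‖z‖ → ‖z‖ ≤ R → ‖F z‖ ≤ B) (j n : ℤ) :
    ‖wlCoef (fun z => z ^ j • F z) n‖ ≤ R⁻¹ ^ (n - j).natAbs * B := by
  have hR0 : 0 < R := by linarith
  have hRi : R⁻¹ < 1 := inv_lt_one_of_one_lt₀ hR
  have hRi0 : 0 < R⁻¹ := inv_pos.2 hR0
  set m : ℤ := j - n with hm
  have e : (∮ z in C(0, 1), z ^ (-n - 1) • z ^ j • F z) = ∮ z in C(0, 1), z ^ (m - 1) • F z := by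
    refine circleIntegral.integral_congr zero_le_one fun z hz => ?_
    have hz0 : z ≠ 0 := wl_norm_ne (by simpa using hz)
    simp only [smul_smul]
    rw [← zpow_add₀ hz0]
    congr 2; omega
  have hdiff : ∀ z : ℂ, R⁻¹ ≤ ‖z‖ → ‖z‖ ≤ R →
      DifferentiableAt ℂ (fun z => z ^ (m - 1) • F z) z := by
    intro z h1 h2
    have hz0 : z ≠ 0 := by rintro rfl; simp at h1; linarith
    exact (differentiableAt_zpow.2 (Or.inl hz0)).smul (hd z h1 h2)
  have shift : ∀ r s : ℝ, R⁻¹ ≤ r → r ≤ s → s ≤ R →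
      (∮ z in C(0, s), z ^ (m - 1) • F z) = ∮ z in C(0, r), z ^ (m - 1) • F z := by
    intro r s h1 h2 h3
    refine Complex.circleIntegral_eq_of_differentiable_on_annulus_off_countable
      (hRi0.trans_le h1) h2 Set.countable_empty ?_ ?_
    · intro z hz
      simp only [Set.mem_sdiff, mem_closedBall_zero_iff, mem_ball_zero_iff, not_lt] at hz
      exact (hdiff z (h1.trans hz.2) (hz.1.trans h3)).continuousAt.continuousWithinAt
    · intro z hz
      simp only [Set.mem_sdiff, mem_closedBall_zero_iff, mem_ball_zero_iff, not_le] at hz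
      exact hdiff z (h1.trans hz.1.2.le) (hz.1.1.le.trans h3)
  have bd : ∀ r : ℝ, R⁻¹ ≤ r → r ≤ R →
      ‖(2 * (Real.pi : ℂ) * Complex.I)⁻¹ • ∮ z in C(0, r), z ^ (m - 1) • F z‖ ≤ r ^ m * B := by
    intro r h1 h2
    have hr : 0 < r := hRi0.trans_le h1
    have := circleIntegral.norm_two_pi_i_inv_smul_integral_le_of_norm_le_const
      (f := fun z => z ^ (m - 1) • F z) (c := 0) (R := r) (C := r ^ (m - 1) * B) hr.le ?_
    · refine this.trans (le_of_eq ?_)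
      rw [zpow_sub_one₀ hr.ne']; field_simp
    · intro z hz
      have hz' : ‖z‖ = r := by simpa using hz
      rw [norm_smul, norm_zpow, hz']
      have := hB z (by rw [hz']; exact h1) (by rw [hz']; exact h2)
      gcongr
  unfold wlCoef
  rw [e]
  rcases le_total m 0 with h | h
  · rw [← shift 1 R hRi.le hR.le le_rfl]
    refine (bd R (hRi.le.trans hR.le) le_rfl).trans (le_of_eq ?_)
    congr 1
    have : m = -((n - j).natAbs : ℤ) := by omega
    rw [this, zpow_neg, zpow_natCast, inv_pow]
  · rw [shift R⁻¹ 1 le_rfl hRi.le hR.le]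
    refine (bd R⁻¹ le_rfl (hRi.le.trans hR.le)).trans (le_of_eq ?_)
    congr 1
    have : m = ((n - j).natAbs : ℤ) := by omega
    rw [this, zpow_natCast]

section
set_option linter.unusedSectionVars false
variable {A : Type*} [NormedRing A] [NormedAlgebra ℂ A] [CompleteSpace A]

theorem wl_norm_term (f : ℤ → A) {z : ℂ} (hz : ‖z‖ = 1) (n : ℤ) : ‖z ^ n • f n‖ = ‖f n‖ := by
  rw [norm_smul, norm_zpow, hz]; simp

theorem wl_hat_summable (f : ℤ → A) (hf : Summable fun n => ‖f n‖) {z : ℂ} (hz : ‖z‖ = 1) :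
    Summable fun n : ℤ => z ^ n • f n :=
  Summable.of_norm (by simpa only [wl_norm_term f hz] using hf)

theorem wl_hat_cont (f : ℤ → A) (hf : Summable fun n => ‖f n‖) :
    ContinuousOn (fun z : ℂ => ∑' n : ℤ, z ^ n • f n) (Metric.sphere 0 1) := by
  refine continuousOn_tsum (fun n => (wl_zpow_cont n).smul continuousOn_const) hf ?_
  intro n z hz
  exact (wl_norm_term f (by simpa using hz) n).le

theorem wl_inv_cont (f : ℤ → A) (hf : Summable fun n => ‖f n‖)
    (hinv : ∀ z : ℂ, ‖z‖ = 1 → IsUnit (∑' n : ℤ, z ^ n • f n)) :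
    ContinuousOn (fun z : ℂ => Ring.inverse (∑' n : ℤ, z ^ n • f n)) (Metric.sphere 0 1) := by
  intro z hz
  obtain ⟨x, hx⟩ := hinv z (by simpa using hz)
  have h1 := NormedRing.inverse_continuousAt x
  rw [hx] at h1
  exact h1.comp_continuousWithinAt (f := fun z : ℂ => ∑' n : ℤ, z ^ n • f n) (wl_hat_cont f hf z hz)

theorem wl_inv_bound (f : ℤ → A) (hf : Summable fun n => ‖f n‖)
    (hinv : ∀ z : ℂ, ‖z‖ = 1 → IsUnit (∑' n : ℤ, z ^ n • f n)) :
    ∃ K : ℝ, 0 < K ∧ ∀ z : ℂ, ‖z‖ = 1 → ‖Ring.inverse (∑' n : ℤ, z ^ n • f n)‖ ≤ K := by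
  obtain ⟨K, hK⟩ := (isCompact_sphere (0 : ℂ) 1).exists_bound_of_continuousOn (wl_inv_cont f hf hinv)
  exact ⟨max K 1, by positivity, fun z hz => (hK z (by simpa using hz)).trans (le_max_left _ _)⟩

theorem wl_conv (f : ℤ → A) (hf : Summable fun n => ‖f n‖) (G : ℂ → A)
    (hG : ContinuousOn G (Metric.sphere 0 1)) (K : ℝ) (hK : ∀ z : ℂ, ‖z‖ = 1 → ‖G z‖ ≤ K)
    (Φ : A → A →L[ℂ] A) (hΦ : ∀ x y, ‖Φ x y‖ ≤ ‖x‖ * ‖y‖)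
    (hone : ∀ z : ℂ, ‖z‖ = 1 → ∑' m : ℤ, z ^ m • Φ (f m) (G z) = 1) (n : ℤ) :
    ∑' m : ℤ, Φ (f m) (wlCoef G (n - m)) = if n = 0 then 1 else 0 := by
  have hs := wl_circle_hasSum (fun (m : ℤ) z => z ^ (-n - 1) • z ^ m • Φ (f m) (G z))
    (fun m => ‖f m‖ * K) (hf.mul_right K) ?_ ?_
  · have h1 := hs.const_smul ((2 * (Real.pi : ℂ) * Complex.I)⁻¹)
    have h2 : (∮ z in C(0, 1), ∑' m : ℤ, z ^ (-n - 1) • z ^ m • Φ (f m) (G z)) =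
        ∮ z in C(0, 1), z ^ (-n - 1) • (1 : A) := by
      refine circleIntegral.integral_congr zero_le_one fun z hz => ?_
      have hz1 : ‖z‖ = 1 := by simpa using hz
      have hz0 := wl_norm_ne hz1
      rw [← hone z hz1]
      refine Summable.tsum_const_smul _ ?_
      refine Summable.of_norm_bounded (hf.mul_right K) fun m => ?_
      rw [norm_smul, norm_zpow, hz1, one_zpow, one_mul]
      exact (hΦ _ _).trans (mul_le_mul_of_nonneg_left (hK z hz1) (norm_nonneg _))
    rw [h2] at h1
    rw [← wl_coef_one (A := A) n]
    unfold wlCoef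
    rw [← h1.tsum_eq]
    congr 1; ext m
    rw [map_smul, ← wl_circle_clm]
    · congr 1
      refine circleIntegral.integral_congr zero_le_one fun z hz => ?_
      have hz1 : ‖z‖ = 1 := by simpa using hz
      have hz0 := wl_norm_ne hz1
      simp only [map_smul, smul_smul]
      rw [← zpow_add₀ hz0]
      congr 2; omega
    · exact (wl_zpow_cont _).smul hG
  · intro m
    exact (wl_zpow_cont _).smul ((wl_zpow_cont _).smul ((Φ (f m)).continuous.comp_continuousOn hG))
  · intro m z hz1
    rw [norm_smul, norm_smul, norm_zpow, norm_zpow, hz1, one_zpow, one_mul, one_zpow, one_mul]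
    exact (hΦ _ _).trans (mul_le_mul_of_nonneg_left (hK z hz1) (norm_nonneg _))

end

theorem wl_summable_of_rpow {ι : Type*} (x : ι → ℝ) (hx : ∀ i, 0 ≤ x i) {p : ℝ} (hp0 : 0 < p)
    (hp1 : p ≤ 1) (h : Summable fun i => x i ^ p) : Summable x := by
  have h1 : ∑' i, ENNReal.ofReal (x i) ^ p ≠ ⊤ := by
    have e : ∀ i, ENNReal.ofReal (x i) ^ p = ENNReal.ofReal (x i ^ p) := fun i =>
      ENNReal.ofReal_rpow_of_nonneg (hx i) hp0.le
    simp_rw [e]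
    rw [← ENNReal.ofReal_tsum_of_nonneg (fun i => Real.rpow_nonneg (hx i) p) h]
    exact ENNReal.ofReal_ne_top
  have h2 := ne_top_of_le_ne_top h1 (wl_rpow_tsum_le (fun i => ENNReal.ofReal (x i)) hp0 hp1)
  have h3 : ∑' i, ENNReal.ofReal (x i) ≠ ⊤ := by
    intro h; rw [h] at h2; simp [hp0] at h2
  refine (ENNReal.summable_toReal h3).congr fun i => ?_
  rw [ENNReal.toReal_ofReal (hx i)]

section
set_option linter.unusedSectionVars false
variable {A : Type*} [NormedRing A] [NormedAlgebra ℂ A] [CompleteSpace A]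

def wlF (Q : ℂ → A) (h : ℤ → A) : List ℤ → ℂ → A
  | [] => Q
  | k :: l => fun z => Q z * h k * wlF Q h l z

theorem wlF_bound (Q : ℂ → A) (h : ℤ → A) {M : ℝ} (hM : 0 ≤ M) {z : ℂ} (hQ : ‖Q z‖ ≤ M)
    (l : List ℤ) : ‖wlF Q h l z‖ ≤ (l.map fun k => M * ‖h k‖).prod * M := by
  induction l with
  | nil => simpa [wlF] using hQ
  | cons k l ih =>
    simp only [wlF, List.map_cons, List.prod_cons]
    calc _ ≤ ‖Q z‖ * ‖h k‖ * ‖wlF Q h l z‖ := (norm_mul_le _ _).trans (by gcongr; exact norm_mul_le _ _)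
      _ ≤ M * ‖h k‖ * ((l.map fun k => M * ‖h k‖).prod * M) := by gcongr
      _ = _ := by ring

theorem wlF_diff (Q : ℂ → A) (h : ℤ → A) {z : ℂ} (hQ : DifferentiableAt ℂ Q z)
    (l : List ℤ) : DifferentiableAt ℂ (wlF Q h l) z := by
  induction l with
  | nil => exact hQ
  | cons k l ih => exact (hQ.mul_const (h k)).mul ih

theorem wl_perturb [NormOneClass A] (x y : A) (hx : IsUnit x) {K : ℝ} (hK : 0 < K)
    (hxK : ‖Ring.inverse x‖ ≤ K) (hxy : ‖y - x‖ ≤ 1 / (6 * K)) :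
    IsUnit y ∧ ‖Ring.inverse y‖ < 3 * K := by
  have : Nontrivial A := NormOneClass.nontrivial
  obtain ⟨u, rfl⟩ := hx
  rw [Ring.inverse_unit] at hxK
  have hpos : 0 < ‖(↑u⁻¹ : A)‖ := Units.norm_pos _
  have hlt : ‖y - u‖ < ‖(↑u⁻¹ : A)‖⁻¹ := by
    have : K⁻¹ ≤ ‖(↑u⁻¹ : A)‖⁻¹ := inv_anti₀ hpos hxK
    refine (hxy.trans_lt ?_).trans_le this
    rw [one_div]
    exact inv_strictAnti₀ hK (by linarith)
  obtain ⟨v, rfl⟩ : IsUnit y := ⟨u.ofNearby y hlt, rfl⟩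
  refine ⟨v.isUnit, ?_⟩
  rw [Ring.inverse_unit]
  have e : (↑v⁻¹ : A) = ↑u⁻¹ - ↑u⁻¹ * ((v : A) - u) * ↑v⁻¹ := by
    rw [mul_sub, sub_mul, mul_assoc, Units.mul_inv, Units.inv_mul]; simp
  have h1 : ‖(↑v⁻¹ : A)‖ ≤ K + K * (1 / (6 * K)) * ‖(↑v⁻¹ : A)‖ := by
    calc ‖(↑v⁻¹ : A)‖ = ‖(↑u⁻¹ : A) - ↑u⁻¹ * ((v : A) - u) * ↑v⁻¹‖ := by rw [← e]
      _ ≤ ‖(↑u⁻¹ : A)‖ + ‖(↑u⁻¹ : A) * ((v : A) - u) * ↑v⁻¹‖ := norm_sub_le _ _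
      _ ≤ ‖(↑u⁻¹ : A)‖ + ‖(↑u⁻¹ : A)‖ * ‖(v : A) - u‖ * ‖(↑v⁻¹ : A)‖ := by
          gcongr
          exact (norm_mul_le _ _).trans (by gcongr; exact norm_mul_le _ _)
      _ ≤ _ := by gcongr
  have h2 : K * (1 / (6 * K)) = 1 / 6 := by field_simp
  rw [h2] at h1
  linarith

/-- the Laurent polynomial stays invertible in an annulus. -/
theorem wl_annulus (S : Finset ℤ) (f : ℤ → A) {M : ℝ}
    (hP : ∀ z : ℂ, ‖z‖ = 1 → IsUnit (∑ n ∈ S, z ^ n • f n) ∧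
      ‖Ring.inverse (∑ n ∈ S, z ^ n • f n)‖ < M) :
    ∃ R : ℝ, 1 < R ∧ ∀ z : ℂ, R⁻¹ ≤ ‖z‖ → ‖z‖ ≤ R →
      IsUnit (∑ n ∈ S, z ^ n • f n) ∧
      DifferentiableAt ℂ (fun z : ℂ => Ring.inverse (∑ n ∈ S, z ^ n • f n)) z ∧
      ‖Ring.inverse (∑ n ∈ S, z ^ n • f n)‖ ≤ M := by
  set P : ℂ → A := fun z => ∑ n ∈ S, z ^ n • f n with hPdef
  have hPd : ∀ z : ℂ, z ≠ 0 → DifferentiableAt ℂ P z := by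
    intro z hz
    refine DifferentiableAt.fun_sum fun n _ => ?_
    exact (differentiableAt_zpow.2 (Or.inl hz)).smul_const _
  have hQd : ∀ z : ℂ, z ≠ 0 → IsUnit (P z) → DifferentiableAt ℂ (fun z => Ring.inverse (P z)) z :=
    fun z hz hu => (differentiableAt_inverse hu).comp z (hPd z hz)
  set U : Set ℂ := {z | z ≠ 0 ∧ IsUnit (P z) ∧ ‖Ring.inverse (P z)‖ < M} with hU
  have hUo : IsOpen U := by
    rw [isOpen_iff_mem_nhds]
    rintro z ⟨h0, h1, h2⟩
    have e1 : ∀ᶠ w in 𝓝 z, w ≠ 0 := isOpen_ne.mem_nhds h0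
    have e2 : ∀ᶠ w in 𝓝 z, IsUnit (P w) := by
      obtain ⟨u, hu⟩ := h1
      have := Units.nhds u
      rw [hu] at this
      exact (hPd z h0).continuousAt.eventually this
    have e3 : ∀ᶠ w in 𝓝 z, ‖Ring.inverse (P w)‖ < M :=
      (hQd z h0 h1).continuousAt.norm.eventually_lt continuousAt_const h2
    filter_upwards [e1, e2, e3] with w a b c using ⟨a, b, c⟩
  obtain ⟨δ, hδ, hsub⟩ := (isCompact_sphere (0 : ℂ) 1).exists_thickening_subset_open hUo
    (fun z hz => ⟨wl_norm_ne (by simpa using hz), hP z (by simpa using hz)⟩)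
  refine ⟨1 + δ / 2, by linarith, fun z h1 h2 => ?_⟩
  have hRi : 1 - δ / 2 ≤ (1 + δ / 2)⁻¹ := by
    rw [← one_div, le_div_iff₀ (by positivity)]; nlinarith
  have hpos : 0 < ‖z‖ := lt_of_lt_of_le (by positivity) h1
  have hz : z ∈ U := by
    apply hsub
    rw [Metric.mem_thickening_iff]
    refine ⟨(‖z‖⁻¹ : ℝ) • z, ?_, ?_⟩
    · simp [hpos.ne']
    · have : z - (‖z‖⁻¹ : ℝ) • z = (1 - ‖z‖⁻¹ : ℝ) • z := by rw [sub_smul, one_smul]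
      rw [dist_eq_norm, this, norm_smul, Real.norm_eq_abs]
      have e : |1 - ‖z‖⁻¹| * ‖z‖ = |‖z‖ - 1| := by
        rw [← abs_of_pos hpos, ← abs_mul, abs_of_pos hpos]
        congr 1; field_simp
      rw [e, abs_lt]
      constructor <;> linarith
  exact ⟨hz.2.1, hQd z hz.1 hz.2.1, hz.2.2.le⟩

theorem wl_choose_S (f : ℤ → A) (w : ℤ → ℝ)
    {ε η : ℝ} (hε : 0 < ε) (hη : 0 < η) :
    ∃ S : Finset ℤ, ∑' n, ‖if n ∈ S then 0 else -f n‖ < ε ∧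
      ∑' n, (if n ∈ S then 0 else w n) < η := by
  have h1 := (tendsto_order.1 (tendsto_tsum_compl_atTop_zero fun n => ‖f n‖)).2 ε hε
  have h2 := (tendsto_order.1 (tendsto_tsum_compl_atTop_zero w)).2 η hη
  obtain ⟨S, hS1, hS2⟩ := (h1.and h2).exists
  refine ⟨S, ?_, ?_⟩
  · refine lt_of_eq_of_lt ?_ hS1
    refine Eq.trans ?_ (tsum_subtype {n : ℤ | n ∉ S} fun n => ‖f n‖).symm
    congr 1; ext n
    by_cases hn : n ∈ S <;> simp [hn]
  · refine lt_of_eq_of_lt ?_ hS2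
    refine Eq.trans ?_ (tsum_subtype {n : ℤ | n ∉ S} w).symm
    congr 1; ext n
    by_cases hn : n ∈ S <;> simp [hn]

/-- Neumann expansion over words. -/
theorem wl_neumann (Q : ℂ → A) (h : ℤ → A) (hh : Summable fun n => ‖h n‖) {M : ℝ} (hM : 0 ≤ M)
    (hM1 : ∑' n, M * ‖h n‖ < 1) {z : ℂ} (hz : ‖z‖ = 1) (hQ : ‖Q z‖ ≤ M) (P G : A)
    (hP : P * Q z = 1) (hG : G * (P - ∑' n : ℤ, z ^ n • h n) = 1) :
    ∑' l : List ℤ, z ^ l.sum • wlF Q h l z = G := by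
  have hz0 := wl_norm_ne hz
  have hs := wl_summable_list (fun k => M * ‖h k‖) (fun k => by positivity) (hh.mul_left M) hM1
  have hsum' : Summable fun l : List ℤ => ‖z ^ l.sum • wlF Q h l z‖ := by
    refine Summable.of_nonneg_of_le (fun _ => norm_nonneg _) (fun l => ?_) (hs.mul_right M)
    rw [norm_smul, norm_zpow, hz, one_zpow, one_mul]
    exact wlF_bound Q h hM hQ l
  have hsum := hsum'.of_norm
  set T := ∑' l : List ℤ, z ^ l.sum • wlF Q h l z with hT
  have hhz : Summable fun n : ℤ => ‖z ^ n • h n‖ := by simpa only [wl_norm_term h hz] using hh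
  have hprod := tsum_mul_tsum_of_summable_norm hhz hsum'
  have hprods := summable_mul_of_summable_norm hhz hsum'
  have hrec : T = Q z + Q z * ((∑' n : ℤ, z ^ n • h n) * T) := by
    have e : ∀ x : ℤ × List ℤ, z ^ (x.1 :: x.2).sum • wlF Q h (x.1 :: x.2) z =
        Q z * ((z ^ x.1 • h x.1) * (z ^ x.2.sum • wlF Q h x.2 z)) := by
      rintro ⟨k, l⟩
      simp only [wlF, List.sum_cons, zpow_add₀ hz0, smul_mul_assoc, mul_smul_comm, smul_smul, mul_assoc]
      rw [mul_comm (z ^ k)]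
    have h2 : HasSum ((fun l : List ℤ => z ^ l.sum • wlF Q h l z) ∘ wlListEquiv)
        (Q z + Q z * ((∑' n : ℤ, z ^ n • h n) * T)) := by
      refine HasSum.sum ?_ ?_
      · simp [wlF, wlListEquiv, Function.comp_def]
      · rw [hT, hprod]
        refine (hprods.hasSum.mul_left (Q z)).congr_fun ?_
        intro x
        exact (e x)
    exact hT.trans (wlListEquiv.hasSum_iff.1 h2).tsum_eq
  have h3 : (P - ∑' n : ℤ, z ^ n • h n) * T = 1 := by
    rw [sub_mul]
    nth_rewrite 1 [hrec]
    rw [mul_add, ← mul_assoc P, hP, one_mul]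
    simp
  calc T = G * (P - ∑' n : ℤ, z ^ n • h n) * T := by rw [hG, one_mul]
    _ = G := by rw [mul_assoc, h3, mul_one]

end

theorem wl_core {A : Type*} [NormedRing A] [NormedAlgebra ℂ A] [CompleteSpace A]
    [NormOneClass A]
    (p : ℝ) (hp0 : 0 < p) (hp1 : p ≤ 1)
    (ω : ℤ → ℝ) (hω : IsWeight ω)
    (f : ℤ → A) (hf : Summable fun n : ℤ => ‖f n‖ ^ p * ω n ^ p)
    (hinv : ∀ z : ℂ, ‖z‖ = 1 → IsUnit (∑' n : ℤ, z ^ n • f n)) :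
    ∃ (R : ℝ) (g : ℤ → A), 1 < R ∧
      (∀ ν : ℤ → ℝ, IsWeight ν → (∀ n, ν n ≤ ω n) →
        (Summable fun n : ℤ => (R⁻¹ ^ n.natAbs * ν n) ^ p) →
        Summable fun n : ℤ => ‖g n‖ ^ p * ν n ^ p) ∧
      (∀ n : ℤ, (∑' m : ℤ, f m * g (n - m)) = if n = 0 then 1 else 0) ∧
      (∀ n : ℤ, (∑' m : ℤ, g m * f (n - m)) = if n = 0 then 1 else 0) := by
  have hω0 : ∀ n, 0 ≤ ω n := fun n => zero_le_one.trans (hω.1 n)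
  have hf1 : Summable fun n => ‖f n‖ := by
    refine wl_summable_of_rpow _ (fun _ => norm_nonneg _) hp0 hp1 ?_
    refine Summable.of_nonneg_of_le (fun n => by positivity) (fun n => ?_) hf
    exact le_mul_of_one_le_right (by positivity) (Real.one_le_rpow (hω.1 n) hp0.le)
  obtain ⟨K, hK0, hK⟩ := wl_inv_bound f hf1 hinv
  set G : ℂ → A := fun z => Ring.inverse (∑' n : ℤ, z ^ n • f n) with hGdef
  have hGc : ContinuousOn G (Metric.sphere 0 1) := wl_inv_cont f hf1 hinv
  set M : ℝ := 3 * K with hMdef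
  have hM0 : 0 < M := by positivity
  obtain ⟨S, hS1, hS2⟩ := wl_choose_S f (fun n => ‖f n‖ ^ p * ω n ^ p)
    (ε := 1 / (6 * K)) (η := 1 / M ^ p) (by positivity) (by positivity)
  set h : ℤ → A := fun n => if n ∈ S then 0 else -f n with hh
  have hhf : ∀ n, ‖h n‖ ≤ ‖f n‖ := by
    intro n
    by_cases hn : n ∈ S <;> simp [hh, hn]
  have hhs : Summable fun n => ‖h n‖ := Summable.of_nonneg_of_le (fun _ => norm_nonneg _) hhf hf1
  have hhat : ∀ z : ℂ, ‖z‖ = 1 → ∑' n : ℤ, z ^ n • f n =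
      ∑ n ∈ S, z ^ n • f n - ∑' n : ℤ, z ^ n • h n := by
    intro z hz
    rw [eq_sub_iff_add_eq, ← (wl_hat_summable f hf1 hz).tsum_add (wl_hat_summable h hhs hz)]
    rw [tsum_eq_sum (s := S)]
    · refine Finset.sum_congr rfl fun n hn => ?_
      simp [hh, hn]
    · intro n hn
      simp [hh, hn]
  have hP : ∀ z : ℂ, ‖z‖ = 1 → IsUnit (∑ n ∈ S, z ^ n • f n) ∧
      ‖Ring.inverse (∑ n ∈ S, z ^ n • f n)‖ < M := by
    intro z hz
    refine wl_perturb _ _ (hinv z hz) hK0 (hK z hz) ?_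
    rw [hhat z hz, sub_sub_cancel]
    refine (norm_tsum_le_tsum_norm ?_).trans ?_
    · simpa only [wl_norm_term h hz] using hhs
    · simp only [wl_norm_term h hz]
      exact hS1.le
  obtain ⟨R, hR, hann⟩ := wl_annulus S f hP
  set Q : ℂ → A := fun z => Ring.inverse (∑ n ∈ S, z ^ n • f n) with hQdef
  have hR0 : 0 < R := by linarith
  have hRi : R⁻¹ ≤ 1 := inv_le_one_of_one_le₀ hR.le
  have hM1 : ∑' n, M * ‖h n‖ < 1 := by
    rw [tsum_mul_left]
    calc M * ∑' n, ‖h n‖ < M * (1 / (6 * K)) := by gcongr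
      _ = 1 / 2 := by rw [hMdef]; field_simp; norm_num
      _ < 1 := by norm_num
  have hsl := wl_summable_list (fun k => M * ‖h k‖) (fun k => by positivity) (hhs.mul_left M) hM1
  have hGsum : ∀ z : ℂ, ‖z‖ = 1 → ∑' l : List ℤ, z ^ l.sum • wlF Q h l z = G z := by
    intro z hz
    obtain ⟨h1, h2, h3⟩ := hann z (by rw [hz]; exact hRi) (by rw [hz]; exact hR.le)
    refine wl_neumann Q h hhs hM0.le hM1 hz h3 (∑ n ∈ S, z ^ n • f n) (G z)
      (Ring.mul_inverse_cancel _ h1) ?_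
    rw [← hhat z hz]
    exact Ring.inverse_mul_cancel _ (hinv z hz)
  have hdF : ∀ (l : List ℤ) (z : ℂ), R⁻¹ ≤ ‖z‖ → ‖z‖ ≤ R → DifferentiableAt ℂ (wlF Q h l) z :=
    fun l z h1 h2 => wlF_diff Q h (hann z h1 h2).2.1 l
  have hbF : ∀ (l : List ℤ) (z : ℂ), R⁻¹ ≤ ‖z‖ → ‖z‖ ≤ R →
      ‖wlF Q h l z‖ ≤ (l.map fun k => M * ‖h k‖).prod * M :=
    fun l z h1 h2 => wlF_bound Q h hM0.le (hann z h1 h2).2.2 l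
  have hgsum : ∀ n : ℤ, wlCoef G n = ∑' l : List ℤ, wlCoef (fun z => z ^ l.sum • wlF Q h l z) n := by
    intro n
    have hs := wl_circle_hasSum (fun (l : List ℤ) z => z ^ (-n - 1) • z ^ l.sum • wlF Q h l z)
      (fun l => (l.map fun k => M * ‖h k‖).prod * M) (hsl.mul_right M) ?_ ?_
    · have h1 := (hs.const_smul ((2 * (Real.pi : ℂ) * Complex.I)⁻¹)).tsum_eq
      unfold wlCoef
      rw [h1]
      congr 1
      refine circleIntegral.integral_congr zero_le_one fun z hz => ?_
      have hz1 : ‖z‖ = 1 := by simpa using hz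
      rw [← hGsum z hz1]
      refine (Summable.tsum_const_smul _ ?_).symm
      refine Summable.of_norm_bounded (hsl.mul_right M) fun l => ?_
      rw [norm_smul, norm_zpow, hz1, one_zpow, one_mul]
      exact hbF l z (by rw [hz1]; exact hRi) (by rw [hz1]; exact hR.le)
    · intro l
      refine (wl_zpow_cont _).smul ((wl_zpow_cont _).smul ?_)
      intro z hz
      have hz1 : ‖z‖ = 1 := by simpa using hz
      exact (hdF l z (by rw [hz1]; exact hRi) (by rw [hz1]; exact hR.le)).continuousAt.continuousWithinAt
    · intro l z hz1
      rw [norm_smul, norm_smul, norm_zpow, norm_zpow, hz1, one_zpow, one_mul, one_zpow, one_mul]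
      exact hbF l z (by rw [hz1]; exact hRi) (by rw [hz1]; exact hR.le)
  have hprod : ∀ l : List ℤ, (l.map fun k => ENNReal.ofReal (M * ‖h k‖)).prod =
      ENNReal.ofReal (l.map fun k => M * ‖h k‖).prod := by
    intro l
    induction l with
    | nil => simp
    | cons k l ih =>
      simp only [List.map_cons, List.prod_cons, ih]
      rw [← ENNReal.ofReal_mul (by positivity)]
  have hprod0 : ∀ l : List ℤ, 0 ≤ (l.map fun k => M * ‖h k‖).prod := fun l =>
    List.prod_nonneg (by
      intro x hx
      obtain ⟨k, -, rfl⟩ := List.mem_map.1 hx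
      positivity)
  have hgbd : ∀ n : ℤ, ENNReal.ofReal ‖wlCoef G n‖ ≤
      ∑' l : List ℤ, (l.map fun k => ENNReal.ofReal (M * ‖h k‖)).prod *
        (fun m : ℤ => ENNReal.ofReal (R⁻¹ ^ m.natAbs * M)) (n - l.sum) := by
    intro n
    rw [hgsum n, ofReal_norm]
    refine enorm_tsum_le_tsum_enorm.trans (ENNReal.tsum_le_tsum fun l => ?_)
    rw [hprod, ← ENNReal.ofReal_mul (hprod0 l), ← ofReal_norm]
    refine ENNReal.ofReal_le_ofReal ?_
    refine (wl_coef_bound hR (wlF Q h l) (hdF l) (hbF l) l.sum n).trans (le_of_eq ?_)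
    ring
  refine ⟨R, wlCoef G, hR, ?_, ?_, ?_⟩
  · intro ν hν hνω hνs
    have hν0 : ∀ n, 0 ≤ ν n := fun n => zero_le_one.trans (hν.1 n)
    have := wl_core_ennreal (fun k => ENNReal.ofReal (M * ‖h k‖))
      (fun m : ℤ => ENNReal.ofReal (R⁻¹ ^ m.natAbs * M)) (fun n => ENNReal.ofReal (ν n))
      (fun n => ENNReal.ofReal ‖wlCoef G n‖) hp0 hp1 ?_ hgbd ?_ ?_
    · refine (ENNReal.summable_toReal this).congr fun n => ?_
      rw [← ENNReal.ofReal_mul (norm_nonneg _),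
        ENNReal.ofReal_rpow_of_nonneg (mul_nonneg (norm_nonneg _) (hν0 n)) hp0.le,
        ENNReal.toReal_ofReal (Real.rpow_nonneg (mul_nonneg (norm_nonneg _) (hν0 n)) p),
        Real.mul_rpow (norm_nonneg _) (hν0 n)]
    · intro m n
      rw [← ENNReal.ofReal_mul (hν0 m)]
      exact ENNReal.ofReal_le_ofReal (hν.2 m n)
    · have hs3 : Summable fun n => if n ∈ S then 0 else ‖f n‖ ^ p * ω n ^ p := by
        refine Summable.of_nonneg_of_le (fun n => ?_) (fun n => ?_) hf
        · have := hω0 n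
          split_ifs <;> positivity
        · have := hω0 n
          split_ifs
          · positivity
          · exact le_rfl
      have hle : ∀ k, (ENNReal.ofReal (M * ‖h k‖) * ENNReal.ofReal (ν k)) ^ p ≤
          ENNReal.ofReal (M ^ p * if k ∈ S then 0 else ‖f k‖ ^ p * ω k ^ p) := by
        intro k
        rw [← ENNReal.ofReal_mul (by positivity),
          ENNReal.ofReal_rpow_of_nonneg (mul_nonneg (by positivity) (hν0 k)) hp0.le]
        refine ENNReal.ofReal_le_ofReal ?_
        rw [Real.mul_rpow (by positivity) (hν0 k), Real.mul_rpow hM0.le (norm_nonneg _), mul_assoc]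
        gcongr
        by_cases hk : k ∈ S
        · simp [hh, hk, hp0.ne']
        · simp only [hh, hk, if_false, norm_neg]
          have := hν0 k
          have := hνω k
          gcongr
      refine (ENNReal.tsum_le_tsum hle).trans_lt ?_
      rw [← ENNReal.ofReal_tsum_of_nonneg _ (hs3.mul_left _), tsum_mul_left]
      · rw [ENNReal.ofReal_lt_one]
        have hMp : 0 < M ^ p := by positivity
        calc _ < M ^ p * (1 / M ^ p) := by gcongr
          _ = 1 := by field_simp
      · intro n
        have := hω0 n
        split_ifs <;> positivity
    · have e : ∀ n : ℤ, (ENNReal.ofReal (R⁻¹ ^ n.natAbs * M) * ENNReal.ofReal (ν n)) ^ p =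
          ENNReal.ofReal (M ^ p * (R⁻¹ ^ n.natAbs * ν n) ^ p) := by
        intro n
        have h0 := hν0 n
        rw [← ENNReal.ofReal_mul (by positivity), ENNReal.ofReal_rpow_of_nonneg (by positivity) hp0.le,
          ← Real.mul_rpow hM0.le (by positivity)]
        congr 2; ring
      simp_rw [e]
      rw [← ENNReal.ofReal_tsum_of_nonneg _ (hνs.mul_left _)]
      · exact ENNReal.ofReal_ne_top
      · intro n
        have h0 := hν0 n
        positivity
  · intro n
    refine wl_conv f hf1 G hGc K hK (fun x => ContinuousLinearMap.mul ℂ A x)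
      (fun x y => norm_mul_le _ _) ?_ n
    intro z hz
    simp only [ContinuousLinearMap.mul_apply', ← smul_mul_assoc]
    rw [(wl_hat_summable f hf1 hz).tsum_mul_right]
    exact Ring.mul_inverse_cancel _ (hinv z hz)
  · intro n
    have := wl_conv f hf1 G hGc K hK (fun x => (ContinuousLinearMap.mul ℂ A).flip x)
      (fun x y => by simpa [mul_comm] using norm_mul_le y x) ?_ n
    · rw [← this, ← (Equiv.subLeft n).tsum_eq]
      simp
    intro z hz
    simp only [ContinuousLinearMap.flip_apply, ContinuousLinearMap.mul_apply', ← mul_smul_comm]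
    rw [(wl_hat_summable f hf1 hz).tsum_mul_left]
    exact Ring.inverse_mul_cancel _ (hinv z hz)

theorem wl_summable_weight {p R C : ℝ} (hp0 : 0 < p) (hR : 1 < R) (ν : ℤ → ℝ) (hν : ∀ n, 1 ≤ ν n)
    (hC : ∀ n : ℤ, ν n ≤ C * (√R) ^ n.natAbs) :
    Summable fun n : ℤ => (R⁻¹ ^ n.natAbs * ν n) ^ p := by
  have hs1 : 1 < √R := by rw [Real.lt_sqrt] <;> linarith
  have hs0 : 0 < √R := by linarith
  have hR0 : 0 < R := by linarith
  have hC0 : 0 ≤ C := by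
    have := (hν 0).trans (hC 0)
    simp at this; linarith
  set q : ℝ := ((√R)⁻¹) ^ p with hq
  have hq0 : 0 ≤ q := by positivity
  have hq1 : q < 1 := Real.rpow_lt_one (by positivity) (inv_lt_one_of_one_lt₀ hs1) hp0
  have hle : ∀ n : ℤ, (R⁻¹ ^ n.natAbs * ν n) ^ p ≤ C ^ p * q ^ n.natAbs := by
    intro n
    have h0 : 0 ≤ ν n := zero_le_one.trans (hν n)
    have h1 : R⁻¹ ^ n.natAbs * ν n ≤ C * (√R)⁻¹ ^ n.natAbs := by
      calc _ ≤ R⁻¹ ^ n.natAbs * (C * (√R) ^ n.natAbs) := by gcongr; exact hC n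
        _ = C * (R⁻¹ * √R) ^ n.natAbs := by rw [mul_pow]; ring
        _ = _ := by
          congr 2
          nth_rewrite 1 [← Real.mul_self_sqrt hR0.le]
          field_simp
    calc _ ≤ (C * (√R)⁻¹ ^ n.natAbs) ^ p := Real.rpow_le_rpow (by positivity) h1 hp0.le
      _ = _ := by
        rw [Real.mul_rpow hC0 (by positivity), hq, ← Real.rpow_natCast, ← Real.rpow_natCast,
          ← Real.rpow_mul (by positivity), ← Real.rpow_mul (by positivity), mul_comm p]
  refine Summable.of_nonneg_of_le (fun n => ?_) hle (Summable.mul_left _ ?_)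
  · have h0 : 0 ≤ ν n := zero_le_one.trans (hν n)
    positivity
  · refine Summable.of_nat_of_neg ?_ ?_ <;> simpa using summable_geometric_of_lt_one hq0 hq1

theorem wl_weight_growth (ω : ℤ → ℝ) (hω : IsWeight ω) {s : ℝ} (hs : 1 ≤ s) (k : ℕ) (hk : 0 < k)
    (h : ω k ≤ s ^ k) : ∃ C : ℝ, 0 ≤ C ∧ ∀ n : ℕ, ω n ≤ C * s ^ n := by
  have h0 : ∀ n, 0 ≤ ω n := fun n => zero_le_one.trans (hω.1 n)
  refine ⟨∑ i ∈ Finset.range k, ω i, Finset.sum_nonneg fun i _ => h0 _, ?_⟩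
  have hm : ∀ q r : ℕ, ω ((k * q + r : ℕ) : ℤ) ≤ (s ^ k) ^ q * ω r := by
    intro q r
    induction q with
    | zero => simp
    | succ q ih =>
      have e : ((k * (q + 1) + r : ℕ) : ℤ) = k + ((k * q + r : ℕ) : ℤ) := by push_cast; ring
      rw [e]
      calc _ ≤ ω k * ω ((k * q + r : ℕ) : ℤ) := hω.2 _ _
        _ ≤ s ^ k * ((s ^ k) ^ q * ω r) := mul_le_mul h ih (h0 _) (by positivity)
        _ = _ := by ring
  intro n
  have h1 := hm (n / k) (n % k)
  rw [Nat.div_add_mod] at h1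
  have h2 : ω ((n % k : ℕ) : ℤ) ≤ ∑ i ∈ Finset.range k, ω i :=
    Finset.single_le_sum (f := fun i : ℕ => ω i) (fun i _ => h0 _) (Finset.mem_range.2 (Nat.mod_lt n hk))
  have h3 : (s ^ k) ^ (n / k) ≤ s ^ n := by
    rw [← pow_mul]
    exact pow_le_pow_right₀ hs (Nat.mul_div_le n k)
  have h4 := h0 ((n % k : ℕ) : ℤ)
  calc ω n ≤ _ := h1
    _ ≤ s ^ n * ∑ i ∈ Finset.range k, ω i := by gcongr
    _ = _ := mul_comm _ _

theorem wl_admissible_growth (ω : ℤ → ℝ) (hω : IsWeight ω) (ha : IsAdmissible ω) {s : ℝ} (hs : 1 < s) :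
    ∃ C : ℝ, ∀ n : ℤ, ω n ≤ C * s ^ n.natAbs := by
  have h0 : ∀ n, 0 < ω n := fun n => zero_lt_one.trans_le (hω.1 n)
  obtain ⟨ha1, ha2⟩ := ha
  have hs0 : 0 < s := by linarith
  have hpos : ∃ k : ℕ, 0 < k ∧ ω k ≤ s ^ k := by
    have hlt : sInf {x : ℝ | ∃ n : ℕ, 0 < n ∧ x = ω (n : ℤ) ^ ((1 : ℝ) / (n : ℝ))} < s :=
      lt_of_eq_of_lt ha2 hs
    have hex := fun hne => exists_lt_of_csInf_lt hne hlt
    obtain ⟨x, ⟨k, hk, rfl⟩, hx⟩ := hex ⟨_, 1, one_pos, rfl⟩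
    refine ⟨k, hk, ?_⟩
    rw [one_div, Real.rpow_inv_lt_iff_of_pos (h0 _).le hs0.le (by exact_mod_cast hk)] at hx
    exact_mod_cast hx.le
  have hneg : ∃ k : ℕ, 0 < k ∧ ω (-k) ≤ s ^ k := by
    have hlt : s⁻¹ < sSup {x : ℝ | ∃ n : ℕ, 0 < n ∧ x = ω (-(n : ℤ)) ^ (-(1 : ℝ) / (n : ℝ))} :=
      (inv_lt_one_of_one_lt₀ hs).trans_eq ha1.symm
    have hex := fun hne => exists_lt_of_lt_csSup hne hlt
    obtain ⟨x, ⟨k, hk, rfl⟩, hx⟩ := hex ⟨_, 1, one_pos, rfl⟩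
    refine ⟨k, hk, ?_⟩
    rw [neg_div, one_div, Real.rpow_neg (h0 _).le, inv_lt_inv₀ hs0 (Real.rpow_pos_of_pos (h0 _) _),
      Real.rpow_inv_lt_iff_of_pos (h0 _).le hs0.le (by exact_mod_cast hk)] at hx
    exact_mod_cast hx.le
  obtain ⟨k, hk, hk'⟩ := hpos
  obtain ⟨j, hj, hj'⟩ := hneg
  obtain ⟨C, hC0, hC⟩ := wl_weight_growth ω hω hs.le k hk hk'
  obtain ⟨D, hD0, hD⟩ := wl_weight_growth (fun n => ω (-n))
    ⟨fun n => hω.1 _, fun m n => by simpa [add_comm] using hω.2 (-m) (-n)⟩ hs.le j hj hj'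
  refine ⟨max C D, fun n => ?_⟩
  obtain ⟨m, rfl | rfl⟩ := n.eq_nat_or_neg
  · simp only [Int.natAbs_natCast]
    exact (hC m).trans (by gcongr; exact le_max_left _ _)
  · simp only [Int.natAbs_neg, Int.natAbs_natCast]
    exact (hD m).trans (by gcongr; exact le_max_right _ _)

theorem wl_not_admissible (ω : ℤ → ℝ) (hω : IsWeight ω) (ha : ¬ IsAdmissible ω) :
    ∃ (r : ℝ) (σ : ℤ), 1 < r ∧ (σ = 1 ∨ σ = -1) ∧ ∀ n : ℕ, r ^ n ≤ ω (σ * n) := by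
  have h0 : ∀ n, 0 < ω n := fun n => zero_lt_one.trans_le (hω.1 n)
  by_cases h2 : rho2 ω = 1
  · have h1 : rho1 ω ≠ 1 := fun h1 => ha ⟨h1, h2⟩
    have hle : ∀ x ∈ {x : ℝ | ∃ n : ℕ, 0 < n ∧ x = ω (-(n : ℤ)) ^ (-(1 : ℝ) / (n : ℝ))}, x ≤ 1 := by
      rintro x ⟨n, hn, rfl⟩
      refine Real.rpow_le_one_of_one_le_of_nonpos (hω.1 _) ?_
      rw [neg_div, neg_nonpos]; positivity
    have hub : ∀ n : ℕ, 0 < n → ω (-(n : ℤ)) ^ (-(1 : ℝ) / (n : ℝ)) ≤ rho1 ω :=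
      fun n hn => le_csSup ⟨1, hle⟩ ⟨n, hn, rfl⟩
    have hr1 : rho1 ω < 1 := lt_of_le_of_ne (csSup_le ⟨_, 1, one_pos, rfl⟩ hle) h1
    have hr0 : 0 < rho1 ω := (Real.rpow_pos_of_pos (h0 _) _).trans_le (hub 1 one_pos)
    refine ⟨(rho1 ω)⁻¹, -1, (one_lt_inv₀ hr0).2 hr1, Or.inr rfl, fun n => ?_⟩
    rcases Nat.eq_zero_or_pos n with rfl | hn
    · simpa using hω.1 0
    have := hub n hn
    rw [neg_div, one_div, Real.rpow_neg (h0 _).le, inv_le_comm₀ (Real.rpow_pos_of_pos (h0 _) _) hr0,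
      Real.le_rpow_inv_iff_of_pos (by positivity) (h0 _).le (by exact_mod_cast hn)] at this
    simpa using this
  · have hge : ∀ x ∈ {x : ℝ | ∃ n : ℕ, 0 < n ∧ x = ω (n : ℤ) ^ ((1 : ℝ) / (n : ℝ))}, 1 ≤ x := by
      rintro x ⟨n, hn, rfl⟩
      exact Real.one_le_rpow (hω.1 _) (by positivity)
    have hlb : ∀ n : ℕ, 0 < n → rho2 ω ≤ ω (n : ℤ) ^ ((1 : ℝ) / (n : ℝ)) :=
      fun n hn => csInf_le ⟨1, hge⟩ ⟨n, hn, rfl⟩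
    have hr1 : 1 < rho2 ω := lt_of_le_of_ne (le_csInf ⟨_, 1, one_pos, rfl⟩ hge) (Ne.symm h2)
    refine ⟨rho2 ω, 1, hr1, Or.inl rfl, fun n => ?_⟩
    rcases Nat.eq_zero_or_pos n with rfl | hn
    · simpa using hω.1 0
    have := hlb n hn
    rw [one_div,
      Real.le_rpow_inv_iff_of_pos (by positivity) (h0 _).le (by exact_mod_cast hn)] at this
    simpa using this

end WienerAux

/-- **Corollary 3.3.** Let `0 < p ≤ 1`, `ω` a weight on `ℤ`, `A` a unital Banach algebra,
and `f ∈ ℓ^p(ℤ,ω,A)`.  If `f̂(z) = ∑ f(n) zⁿ` is invertible in `A` for every `z ∈ 𝕋`,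
then there are a weight `ν` with `1 ≤ ν ≤ ω`, `ν` constant iff `ω` constant, and
`g ∈ ℓ^p(ℤ,ν,A)` with `f ⋆ g = g ⋆ f = δ₀`.  In particular, if `ω` is admissible then
`g` can be taken in `ℓ^p(ℤ,ω,A)`. -/
theorem stmt10 {A : Type*} [NormedRing A] [NormedAlgebra ℂ A] [CompleteSpace A]
    [NormOneClass A]
    (p : ℝ) (hp0 : 0 < p) (hp1 : p ≤ 1)
    (ω : ℤ → ℝ) (hω : IsWeight ω)
    (f : ℤ → A) (hf : Summable fun n : ℤ => ‖f n‖ ^ p * ω n ^ p)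
    (hinv : ∀ z : ℂ, ‖z‖ = 1 → IsUnit (∑' n : ℤ, z ^ n • f n)) :
    (∃ (ν : ℤ → ℝ) (g : ℤ → A), IsWeight ν ∧
        (∀ n, 1 ≤ ν n ∧ ν n ≤ ω n) ∧
        ((∃ c, ∀ n, ν n = c) ↔ (∃ c, ∀ n, ω n = c)) ∧
        (Summable fun n : ℤ => ‖g n‖ ^ p * ν n ^ p) ∧
        (∀ n : ℤ, (∑' m : ℤ, f m * g (n - m)) = if n = 0 then 1 else 0) ∧
        (∀ n : ℤ, (∑' m : ℤ, g m * f (n - m)) = if n = 0 then 1 else 0)) ∧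
      (IsAdmissible ω → ∃ g : ℤ → A,
        (Summable fun n : ℤ => ‖g n‖ ^ p * ω n ^ p) ∧
        (∀ n : ℤ, (∑' m : ℤ, f m * g (n - m)) = if n = 0 then 1 else 0) ∧
        (∀ n : ℤ, (∑' m : ℤ, g m * f (n - m)) = if n = 0 then 1 else 0)) := by
  obtain ⟨R, g, hR, hg, hc1, hc2⟩ := wl_core p hp0 hp1 ω hω f hf hinv
  have hs1 : 1 < √R := by rw [Real.lt_sqrt] <;> linarith
  have hadm : IsAdmissible ω → Summable fun n : ℤ => ‖g n‖ ^ p * ω n ^ p := by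
    intro ha
    obtain ⟨C, hC⟩ := wl_admissible_growth ω hω ha hs1
    exact hg ω hω (fun n => le_rfl) (wl_summable_weight hp0 hR ω hω.1 hC)
  refine ⟨?_, fun ha => ⟨g, hadm ha, hc1, hc2⟩⟩
  by_cases ha : IsAdmissible ω
  · exact ⟨ω, g, hω, fun n => ⟨hω.1 n, le_rfl⟩, Iff.rfl, hadm ha, hc1, hc2⟩
  obtain ⟨r₀, σ, hr₀, hσ, hlow⟩ := wl_not_admissible ω hω ha
  have hσσ : σ * σ = 1 := by rcases hσ with rfl | rfl <;> norm_num
  set r : ℝ := min r₀ (√R) with hr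
  have hr1 : 1 < r := lt_min hr₀ hs1
  have hr0 : 0 < r := by linarith
  set ν : ℤ → ℝ := fun n => r ^ (σ * n).toNat with hν
  have hν1 : ∀ n, 1 ≤ ν n := fun n => one_le_pow₀ hr1.le
  have hνw : IsWeight ν := by
    refine ⟨hν1, fun m n => ?_⟩
    simp only [hν]
    rw [← pow_add]
    refine pow_le_pow_right₀ hr1.le ?_
    rw [mul_add]
    omega
  have hνle : ∀ n, ν n ≤ ω n := by
    intro n
    rcases le_total 0 (σ * n) with h | h
    · calc ν n ≤ r₀ ^ (σ * n).toNat := pow_le_pow_left₀ hr0.le (min_le_left _ _) _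
        _ ≤ ω (σ * ((σ * n).toNat : ℤ)) := hlow _
        _ = ω n := by rw [Int.toNat_of_nonneg h, ← mul_assoc, hσσ, one_mul]
    · have e : (σ * n).toNat = 0 := by omega
      simp only [hν, e, pow_zero]
      exact hω.1 n
  have hνv : ∀ n : ℕ, ν (σ * n) = r ^ n := by
    intro n
    simp only [hν]
    rw [← mul_assoc, hσσ, one_mul, Int.toNat_natCast]
  have hνs : Summable fun n : ℤ => (R⁻¹ ^ n.natAbs * ν n) ^ p := by
    refine wl_summable_weight (C := 1) hp0 hR ν hν1 fun n => ?_
    rw [one_mul]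
    calc ν n ≤ (√R) ^ (σ * n).toNat := pow_le_pow_left₀ hr0.le (min_le_right _ _) _
      _ ≤ _ := by
        refine pow_le_pow_right₀ hs1.le ?_
        rcases hσ with rfl | rfl <;> omega
  have hunb : ∀ c : ℝ, ∃ n, c < ν n := by
    intro c
    obtain ⟨n, hn⟩ := pow_unbounded_of_one_lt c hr1
    exact ⟨σ * n, by rw [hνv]; exact hn⟩
  refine ⟨ν, g, hνw, fun n => ⟨hν1 n, hνle n⟩, ⟨?_, ?_⟩, hg ν hνw hνle hνs, hc1, hc2⟩
  · rintro ⟨c, hc⟩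
    obtain ⟨n, hn⟩ := hunb c
    exact absurd (hc n) hn.ne'
  · rintro ⟨c, hc⟩
    obtain ⟨n, hn⟩ := hunb c
    exact absurd ((hνle n).trans (hc n).le) (not_le.2 hn)
end

section
/- Let 1 < p < ∞ with conjugate index q, let ω be an almost monotone algebra weight on ℤ, let A be a unital Banach algebra with unit e, and let f : ℤ → A satisfy ∑_{n∈ℤ} ‖f(n)‖^p ω(n)^p < ∞. If f̂(z) := ∑_{n∈ℤ} f(n) zⁿ is invertible in A for every z ∈ 𝕋 = {z ∈ ℂ : |z| = 1}, then there exist an almost monotone algebra weight ν on ℤ with 1 ≤ ν(n) ≤ K ω(n) for all n ∈ ℤ for some K > 0, and a function g : ℤ → A with ∑_{n∈ℤ} ‖g(n)‖^p ν(n)^p < ∞ such that (f ⋆ g)(n) = (g ⋆ f)(n) = δ₀(n) for all n ∈ ℤ, where δ₀(0) = e and δ₀(n) = 0 for n ≠ 0. In particular, if ω is admissible, then g can be taken with ∑_{n∈ℤ} ‖g(n)‖^p ω(n)^p < ∞. -/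
open scoped BigOperators

/-- An almost monotone algebra weight on `ℤ` (for conjugate index `q`). -/
def IsAMAW (q : ℝ) (ω : ℤ → ℝ) : Prop :=
  IsWeight ω ∧
  (∀ n : ℤ, (∑' k : ℤ, ω k ^ (-q) * ω (n - k) ^ (-q)) ≤ ω n ^ (-q)) ∧
  (Summable fun n : ℤ => ω n ^ (-q)) ∧
  (rho1 ω = 1 → ∃ K > (0 : ℝ), ∀ n k : ℤ, n ≤ -1 → k ≤ -1 → ω n ≤ K * ω (n + k)) ∧
  (rho2 ω = 1 → ∃ K > (0 : ℝ), ∀ n k : ℤ, 0 ≤ n → 0 ≤ k → ω n ≤ K * ω (n + k))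



theorem schur_aux {B : Type*} [NormedRing B] [NormedSpace ℂ B] [IsScalarTower ℂ B B]
    [SMulCommClass ℂ B B] [CompleteSpace B] (L : Submodule B B) (hL : IsCoatom L)
    [hc : IsClosed (L : Set B)] (u : B) (hu : ∀ b, u * b = b * u) :
    ∃ z : ℂ, ∀ b, u * b - z • b ∈ L := by
  have hsimp : IsSimpleModule B (B ⧸ L) := isSimpleModule_iff_isCoatom.mpr hL
  have hnt : Nontrivial (B ⧸ L) := IsSimpleModule.nontrivial B (B ⧸ L)
  have hst : IsScalarTower ℂ B (B ⧸ L) := ⟨fun z b x => by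
    obtain ⟨x, rfl⟩ := Submodule.Quotient.mk_surjective L x
    rw [← Submodule.Quotient.mk_smul, ← Submodule.Quotient.mk_smul, ← Submodule.Quotient.mk_smul,
      smul_assoc]⟩
  let φ : ℂ → (B ⧸ L) →ₗ[B] (B ⧸ L) := fun z =>
    L.mapQ L (LinearMap.toSpanSingleton B B (u - z • 1)) (by
      intro b hb
      have : b * (u - z • (1:B)) = (u - z • (1:B)) * b := by
        rw [mul_sub, sub_mul, hu, mul_smul_comm, smul_mul_assoc, mul_one, one_mul]
      simp only [Submodule.mem_comap, LinearMap.toSpanSingleton_apply, smul_eq_mul]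
      rw [this]
      exact L.smul_mem _ hb)
  have hφ : ∀ z b, φ z (Submodule.Quotient.mk b) = Submodule.Quotient.mk (u * b - z • b) := by
    intro z b
    simp only [φ, Submodule.mapQ_apply, LinearMap.toSpanSingleton_apply, smul_eq_mul]
    rw [mul_sub, mul_smul_comm, mul_one, hu]
  have hbd : ∀ x, ‖φ 0 x‖ ≤ ‖u‖ * ‖x‖ := by
    intro x
    have key : ∀ ε > 0, ‖φ 0 x‖ ≤ ‖u‖ * (‖x‖ + ε) := by
      intro ε hε
      obtain ⟨b, rfl, hb⟩ := Submodule.Quotient.norm_mk_lt x hε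
      rw [hφ, zero_smul, sub_zero]
      refine (Submodule.Quotient.norm_mk_le L _).trans ((norm_mul_le _ _).trans ?_)
      gcongr
    have : Filter.Tendsto (fun ε : ℝ => ‖u‖ * (‖x‖ + ε)) (nhdsWithin 0 (Set.Ioi 0))
        (nhds (‖u‖ * (‖x‖ + 0))) := by
      apply Filter.Tendsto.mono_left _ nhdsWithin_le_nhds
      exact (by fun_prop : Continuous fun ε : ℝ => ‖u‖ * (‖x‖ + ε)).tendsto 0
    rw [add_zero] at this
    exact ge_of_tendsto this (Filter.eventually_of_mem self_mem_nhdsWithin key)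
  let T : (B ⧸ L) →L[ℂ] (B ⧸ L) := ((φ 0).restrictScalars ℂ).mkContinuous ‖u‖ hbd
  obtain ⟨z, hz⟩ := spectrum.nonempty T
  refine ⟨z, ?_⟩
  have hT : ∀ x, (T - algebraMap ℂ _ z) x = φ z x := by
    intro x
    obtain ⟨b, rfl⟩ := Submodule.Quotient.mk_surjective L x
    rw [hφ, ContinuousLinearMap.sub_apply, Algebra.algebraMap_eq_smul_one,
      ContinuousLinearMap.smul_apply, ContinuousLinearMap.one_apply, Submodule.Quotient.mk_sub,
      Submodule.Quotient.mk_smul]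
    congr 1
    change φ 0 _ = _
    rw [hφ, zero_smul, sub_zero]
  rcases (φ z).bijective_or_eq_zero with h | h
  · exfalso
    have : IsUnit (T - algebraMap ℂ _ z) := by
      rw [ContinuousLinearMap.isUnit_iff_bijective]
      convert h using 1
      ext x; exact hT x
    rw [spectrum.mem_iff] at hz
    apply hz
    rw [← neg_sub]; exact this.neg
  · intro b
    rw [← Submodule.Quotient.mk_eq_zero, ← hφ, h]; rfl

theorem left_inv_aux {A B : Type*} [NormedRing A] [NormedAlgebra ℂ A] [CompleteSpace A]
    [NormedRing B] [NormedSpace ℂ B]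
    [IsScalarTower ℂ B B] [SMulCommClass ℂ B B] [CompleteSpace B]
    (ι : A →L[ℂ] B) (ι_mul : ∀ a b, ι (a * b) = ι a * ι b) (ι_one : ι 1 = 1)
    (δ : ℤ → B) (δ0 : δ 0 = 1) (δ_add : ∀ m n, δ (m + n) = δ m * δ n)
    (hcent : ∀ n b, δ n * b = b * δ n)
    (hgr : ∀ r : ℝ, 1 < r → ∃ C : ℝ, ∀ n : ℤ, ‖δ n‖ ≤ C * r ^ n.natAbs)
    (f : ℤ → A) (F : B) (hF : HasSum (fun n => ι (f n) * δ n) F)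
    (hfs : Summable fun n => ‖f n‖)
    (hinv : ∀ z : ℂ, ‖z‖ = 1 → ∃ a : A, a * (∑' n : ℤ, z ^ n • f n) = 1) :
    ∃ h : B, h * F = 1 := by
  by_contra hcon
  have hne : (Ideal.span {F} : Ideal B) ≠ ⊤ := by
    intro h
    rw [Ideal.eq_top_iff_one, Ideal.mem_span_singleton'] at h
    exact hcon h
  obtain ⟨L, hLmax, hFL⟩ := Ideal.exists_le_maximal _ hne
  have hFL : F ∈ L := hFL (Ideal.subset_span rfl)
  have hLco : IsCoatom (L : Submodule B B) := hLmax.out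
  haveI hcl : IsClosed (L : Set B) := Ideal.IsMaximal.isClosed
  have h1L : (1 : B) ∉ L := (Ideal.ne_top_iff_one L).mp hLmax.ne_top
  have hLsmul : ∀ (z : ℂ) (b : B), b ∈ L → z • b ∈ L := by
    intro z b hb
    have := L.mul_mem_left (z • (1:B)) hb
    rwa [smul_mul_assoc, one_mul] at this
  -- characters
  choose χ hχ using fun n : ℤ => schur_aux L hLco (δ n) (hcent n)
  have hχ1 : ∀ n, δ n - χ n • (1 : B) ∈ L := fun n => by simpa using hχ n 1
  have huniq : ∀ z : ℂ, z • (1 : B) ∈ L → z = 0 := by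
    intro z hz
    by_contra hz0
    apply h1L
    have := hLsmul z⁻¹ _ hz
    rwa [smul_smul, inv_mul_cancel₀ hz0, one_smul] at this
  have χ0 : χ 0 = 1 := by
    have h := hχ1 0
    rw [δ0] at h
    have : (1 - χ 0) • (1 : B) ∈ L := by rwa [sub_smul, one_smul]
    exact (sub_eq_zero.mp (huniq _ this)).symm
  have χadd : ∀ m n, χ (m + n) = χ m * χ n := by
    intro m n
    have h1 := hχ1 (m + n)
    have h2 := hχ m (δ n)
    have h3 := hLsmul (χ m) _ (hχ1 n)
    rw [δ_add] at h1
    have h4 := L.sub_mem (L.add_mem h2 h3) h1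
    have : (χ (m + n) - χ m * χ n) • (1 : B) ∈ L := by
      convert h4 using 1
      rw [sub_smul, smul_sub, smul_smul]; abel
    exact sub_eq_zero.mp (huniq _ this)
  have χne : ∀ n, χ n ≠ 0 := by
    intro n h
    have := χadd n (-n)
    rw [add_neg_cancel, χ0, h, zero_mul] at this
    exact one_ne_zero this
  have χpow : ∀ n : ℤ, χ n = χ 1 ^ n := by
    intro n
    induction n using Int.induction_on with
    | zero => simpa using χ0
    | succ i ih => rw [χadd, ih, zpow_add_one₀ (χne 1)]
    | pred i ih =>
      have := χadd (-(i:ℤ) - 1) 1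
      rw [sub_add_cancel, ih] at this
      rw [zpow_sub_one₀ (χne 1), this, mul_assoc, mul_inv_cancel₀ (χne 1), mul_one]
  -- growth
  have hq1 : 0 < ‖(Submodule.Quotient.mk (1 : B) : B ⧸ (L : Submodule B B))‖ := by
    rw [norm_pos_iff]
    intro h
    exact h1L ((Submodule.Quotient.mk_eq_zero _).mp h)
  set c := ‖(Submodule.Quotient.mk (1 : B) : B ⧸ (L : Submodule B B))‖ with hc
  have hχle : ∀ n, ‖χ n‖ * c ≤ ‖δ n‖ := by
    intro n
    rw [hc, ← norm_smul, ← Submodule.Quotient.mk_smul]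
    have : (Submodule.Quotient.mk (χ n • 1 : B) : B ⧸ (L : Submodule B B))
        = Submodule.Quotient.mk (δ n) := by
      symm
      rw [Submodule.Quotient.eq]; exact hχ1 n
    rw [this]
    exact Submodule.Quotient.norm_mk_le _ _
  have hle1 : ∀ z : ℂ, (∀ r : ℝ, 1 < r → ∃ C : ℝ, ∀ n : ℕ, ‖z‖ ^ n ≤ C * r ^ n) → ‖z‖ ≤ 1 := by
    intro z hz
    by_contra! h
    obtain ⟨r, hr1, hr2⟩ := exists_between h
    obtain ⟨C, hC⟩ := hz r hr1
    have hr0 : 0 < r := by linarith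
    have : Filter.Tendsto (fun n : ℕ => (‖z‖ / r) ^ n) Filter.atTop Filter.atTop :=
      tendsto_pow_atTop_atTop_of_one_lt ((one_lt_div hr0).mpr hr2)
    obtain ⟨n, hn⟩ := (this.eventually_gt_atTop C).exists
    rw [div_pow, lt_div_iff₀ (by positivity)] at hn
    exact absurd (hC n) (not_le.mpr hn)
  have hn1 : ‖χ 1‖ = 1 := by
    apply le_antisymm
    · apply hle1
      intro r hr
      obtain ⟨C, hC⟩ := hgr r hr
      refine ⟨C / c, fun n => ?_⟩
      have h := (hχle n).trans (hC n)
      rw [χpow, zpow_natCast, norm_pow, Int.natAbs_natCast] at h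
      rw [div_mul_eq_mul_div, le_div_iff₀ hq1]; exact h
    · have : ‖(χ 1)⁻¹‖ ≤ 1 := by
        apply hle1
        intro r hr
        obtain ⟨C, hC⟩ := hgr r hr
        refine ⟨C / c, fun n => ?_⟩
        have h := (hχle (-n)).trans (hC (-n))
        rw [χpow, zpow_neg, zpow_natCast, ← inv_pow, norm_pow, Int.natAbs_neg,
          Int.natAbs_natCast] at h
        rw [div_mul_eq_mul_div, le_div_iff₀ hq1]; exact h
      rw [norm_inv] at this
      exact (inv_le_one₀ (norm_pos_iff.mpr (χne 1))).mp this
  obtain ⟨a, ha⟩ := hinv (χ 1) hn1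
  have hs2 : Summable (fun n : ℤ => χ 1 ^ n • f n) := by
    apply Summable.of_norm
    simpa [norm_smul, norm_zpow, hn1] using hfs
  have hs3 := hs2.hasSum.mapL ι
  have hs4 := hF.sub hs3
  have hmem : F - ι (∑' n : ℤ, χ 1 ^ n • f n) ∈ L := by
    apply hcl.mem_of_tendsto hs4
    refine Filter.Eventually.of_forall fun s => ?_
    apply L.sum_mem
    intro n _
    have := L.mul_mem_left (ι (f n)) (hχ1 n)
    rw [mul_sub, mul_smul_comm, mul_one, χpow] at this
    simpa using this
  have hmem2 : ι (∑' n : ℤ, χ 1 ^ n • f n) ∈ L := by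
    have := L.sub_mem hFL hmem
    rwa [sub_sub_cancel] at this
  have := L.mul_mem_left (ι a) hmem2
  rw [← ι_mul, ha, ι_one] at this
  exact h1L this
open scoped ENNReal

section conv
variable {A : Type*} [NormedRing A] [NormedAlgebra ℂ A]

theorem young_aux {P : ℝ≥0∞} [Fact (1 ≤ P)] (hP : 0 < P.toReal) (F G : lp (fun _ : ℤ => A) P) :
    (∀ n : ℤ, Summable fun m : ℤ => (‖F m‖ * ‖G (n - m)‖) ^ P.toReal) ∧
    HasSum (fun n : ℤ => ∑' m : ℤ, (‖F m‖ * ‖G (n - m)‖) ^ P.toReal)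
      ((‖F‖ * ‖G‖) ^ P.toReal) := by
  have hF := lp.hasSum_norm hP F
  have hG := lp.hasSum_norm hP G
  have hs : Summable (fun x : ℤ × ℤ => ‖F x.1‖ ^ P.toReal * ‖G x.2‖ ^ P.toReal) :=
    hF.summable.mul_of_nonneg hG.summable (fun _ => by positivity) (fun _ => by positivity)
  have hprod := hF.mul hG hs
  let e : ℤ × ℤ ≃ ℤ × ℤ :=
    { toFun := fun x => (x.2, x.1 - x.2)
      invFun := fun x => (x.1 + x.2, x.1)
      left_inv := fun x => by ext <;> simp
      right_inv := fun x => by ext <;> simp }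
  have h2 := (e.hasSum_iff).mpr hprod
  have h3 : HasSum (fun x : ℤ × ℤ => (‖F x.2‖ * ‖G (x.1 - x.2)‖) ^ P.toReal)
      ((‖F‖ * ‖G‖) ^ P.toReal) := by
    rw [Real.mul_rpow (norm_nonneg _) (norm_nonneg _)]
    have h5 : (fun x : ℤ × ℤ => (‖F x.2‖ * ‖G (x.1 - x.2)‖) ^ P.toReal)
        = (fun x : ℤ × ℤ => ‖F x.1‖ ^ P.toReal * ‖G x.2‖ ^ P.toReal) ∘ e := by
      funext x
      exact Real.mul_rpow (norm_nonneg _) (norm_nonneg _)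
    rw [h5]
    exact h2
  have h4 : ∀ n : ℤ, Summable fun m : ℤ => (‖F m‖ * ‖G (n - m)‖) ^ P.toReal :=
    fun n => h3.summable.prod_factor n
  exact ⟨h4, h3.prod_fiberwise fun n => (h4 n).hasSum⟩

theorem conv_bound {P : ℝ≥0∞} [Fact (1 ≤ P)] {q : ℝ} (hpq : P.toReal.HolderConjugate q) (c : ℤ → ℤ → ℝ)
    (hc0 : ∀ n m, 0 ≤ c n m) (hcs : ∀ n, Summable fun m => c n m ^ q)
    (hc1 : ∀ n, ∑' m, c n m ^ q ≤ 1) (F G : lp (fun _ : ℤ => A) P) (n : ℤ) :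
    (Summable fun m => ‖(c n m : ℂ) • (F m * G (n - m))‖) ∧
    ‖∑' m, (c n m : ℂ) • (F m * G (n - m))‖ ^ P.toReal
      ≤ ∑' m : ℤ, (‖F m‖ * ‖G (n - m)‖) ^ P.toReal := by
  have hP := hpq.pos
  obtain ⟨h1, h2⟩ := Real.summable_and_inner_le_Lp_mul_Lq_tsum_of_nonneg hpq
    (f := fun m => ‖F m‖ * ‖G (n - m)‖) (g := fun m => c n m)
    (fun _ => by positivity) (hc0 n) ((young_aux hP F G).1 n) (hcs n)
  have hle : ∀ m, ‖(c n m : ℂ) • (F m * G (n - m))‖ ≤ ‖F m‖ * ‖G (n - m)‖ * c n m := by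
    intro m
    rw [norm_smul, Complex.norm_real, Real.norm_of_nonneg (hc0 n m), mul_comm]
    gcongr
    · exact hc0 n m
    · exact norm_mul_le _ _
  have hs : Summable fun m => ‖(c n m : ℂ) • (F m * G (n - m))‖ :=
    Summable.of_nonneg_of_le (fun _ => norm_nonneg _) hle h1
  refine ⟨hs, ?_⟩
  have h3 : ‖∑' m, (c n m : ℂ) • (F m * G (n - m))‖
      ≤ (∑' m : ℤ, (‖F m‖ * ‖G (n - m)‖) ^ P.toReal) ^ (1 / P.toReal) := by
    refine (norm_tsum_le_tsum_norm hs).trans ((hs.tsum_le_tsum hle h1).trans (h2.trans ?_))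
    have h0 : 0 ≤ ∑' m, c n m ^ q := tsum_nonneg fun m => Real.rpow_nonneg (hc0 n m) _
    refine mul_le_of_le_one_right (Real.rpow_nonneg (tsum_nonneg fun m => by positivity) _) ?_
    exact Real.rpow_le_one h0 (hc1 n) (by have := hpq.symm.pos; positivity)
  calc _ ≤ ((∑' m : ℤ, (‖F m‖ * ‖G (n - m)‖) ^ P.toReal) ^ (1 / P.toReal)) ^ P.toReal := by
        gcongr
    _ = _ := by
        rw [← Real.rpow_mul (tsum_nonneg fun m => by positivity), one_div,
          inv_mul_cancel₀ hP.ne', Real.rpow_one]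

theorem exists_conv [CompleteSpace A] {P : ℝ≥0∞} [Fact (1 ≤ P)] {q : ℝ}
    (hpq : P.toReal.HolderConjugate q)
    (c : ℤ → ℤ → ℝ)
    (hc0 : ∀ n m, 0 ≤ c n m) (hcs : ∀ n, Summable fun m => c n m ^ q)
    (hc1 : ∀ n, ∑' m, c n m ^ q ≤ 1) :
    ∃ C : lp (fun _ : ℤ => A) P →L[ℂ] lp (fun _ : ℤ => A) P →L[ℂ] lp (fun _ : ℤ => A) P,
      (∀ F G, ‖C F G‖ ≤ ‖F‖ * ‖G‖) ∧
      ∀ F G n, C F G n = ∑' m, (c n m : ℂ) • (F m * G (n - m)) := by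
  have hP := hpq.pos
  have hb := fun F G => conv_bound (A := A) hpq c hc0 hcs hc1 F G
  have hsum : ∀ (F G : lp (fun _ : ℤ => A) P),
      Summable fun n => ‖∑' m, (c n m : ℂ) • (F m * G (n - m))‖ ^ P.toReal := fun F G =>
    Summable.of_nonneg_of_le (fun _ => by positivity) (fun n => (hb F G n).2)
      (young_aux hP F G).2.summable
  let M : lp (fun _ : ℤ => A) P → lp (fun _ : ℤ => A) P → lp (fun _ : ℤ => A) P := fun F G =>
    ⟨fun n => ∑' m, (c n m : ℂ) • (F m * G (n - m)), memℓp_gen (hsum F G)⟩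
  have hM : ∀ F G n, M F G n = ∑' m, (c n m : ℂ) • (F m * G (n - m)) := fun _ _ _ => rfl
  have hs : ∀ (F G : lp (fun _ : ℤ => A) P) n,
    Summable fun m => (c n m : ℂ) • (F m * G (n - m)) := fun F G n => (hb F G n).1.of_norm
  have hnorm : ∀ F G, ‖M F G‖ ≤ ‖F‖ * ‖G‖ := by
    intro F G
    apply lp.norm_le_of_tsum_le hP (by positivity)
    rw [← (young_aux hP F G).2.tsum_eq]
    exact (hsum F G).tsum_le_tsum (fun n => (hb F G n).2) (young_aux hP F G).2.summable
  let Cl : lp (fun _ : ℤ => A) P →ₗ[ℂ] lp (fun _ : ℤ => A) P →ₗ[ℂ] lp (fun _ : ℤ => A) P :=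
    LinearMap.mk₂ ℂ M
      (fun F F' G => by
        ext n
        rw [lp.coeFn_add, Pi.add_apply, hM, hM, hM, ← (hs F G n).tsum_add (hs F' G n)]
        simp [add_mul])
      (fun z F G => by
        ext n
        rw [lp.coeFn_smul, Pi.smul_apply, hM, hM, ← (hs F G n).tsum_const_smul]
        congr 1; ext m
        rw [lp.coeFn_smul, Pi.smul_apply, smul_mul_assoc, smul_comm])
      (fun F G G' => by
        ext n
        rw [lp.coeFn_add, Pi.add_apply, hM, hM, hM, ← (hs F G n).tsum_add (hs F G' n)]
        simp [mul_add])
      (fun z F G => by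
        ext n
        rw [lp.coeFn_smul, Pi.smul_apply, hM, hM, ← (hs F G n).tsum_const_smul]
        congr 1; ext m
        rw [lp.coeFn_smul, Pi.smul_apply, mul_smul_comm, smul_comm])
  refine ⟨Cl.mkContinuous₂ 1 (fun F G => by rw [one_mul]; exact hnorm F G), ?_, ?_⟩
  · intro F G; exact hnorm F G
  · intro F G n; rfl

theorem lp_clm_ext {P : ℝ≥0∞} [Fact (1 ≤ P)] (hP : P ≠ ⊤) {Y : Type*} [NormedAddCommGroup Y]
    [NormedSpace ℂ Y] (Φ Ψ : lp (fun _ : ℤ => A) P →L[ℂ] Y)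
    (h : ∀ i a, Φ (lp.single P i a) = Ψ (lp.single P i a)) (F) : Φ F = Ψ F := by
  have h1 := (lp.hasSum_single hP F).mapL Φ
  have h2 := (lp.hasSum_single hP F).mapL Ψ
  simp only [h] at h1
  exact h1.unique h2

theorem exists_eval [CompleteSpace A] {P : ℝ≥0∞} [Fact (1 ≤ P)] {q : ℝ}
    (hpq : P.toReal.HolderConjugate q)
    (d : ℤ → ℂ) (hd : Summable fun n => ‖d n‖ ^ q) :
    (∀ F : lp (fun _ : ℤ => A) P, Summable fun n => ‖d n • F n‖) ∧
    ∃ E : lp (fun _ : ℤ => A) P →L[ℂ] A, ∀ F, E F = ∑' n, d n • F n := by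
  have hP := hpq.pos
  have key : ∀ F : lp (fun _ : ℤ => A) P, (Summable fun n => ‖d n • F n‖) ∧
      ‖∑' n, d n • F n‖ ≤ (∑' n, ‖d n‖ ^ q) ^ (1 / q) * ‖F‖ := by
    intro F
    obtain ⟨h1, h2⟩ := Real.summable_and_inner_le_Lp_mul_Lq_tsum_of_nonneg hpq.symm
      (f := fun m => ‖d m‖) (g := fun m => ‖F m‖)
      (fun _ => norm_nonneg _) (fun _ => norm_nonneg _) hd (lp.hasSum_norm hP F).summable
    simp only [← norm_smul] at h1 h2
    refine ⟨h1, (norm_tsum_le_tsum_norm h1).trans (h2.trans ?_)⟩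
    rw [(lp.hasSum_norm hP F).tsum_eq, ← Real.rpow_mul (norm_nonneg _), mul_one_div_cancel hP.ne',
      Real.rpow_one]
  refine ⟨fun F => (key F).1, ?_⟩
  let El : lp (fun _ : ℤ => A) P →ₗ[ℂ] A :=
    { toFun := fun F => ∑' n, d n • F n
      map_add' := fun F G => by
        rw [← (key F).1.of_norm.tsum_add (key G).1.of_norm]; simp
      map_smul' := fun z F => by
        rw [RingHom.id_apply, ← (key F).1.of_norm.tsum_const_smul]
        congr 1; ext m
        rw [lp.coeFn_smul, Pi.smul_apply, smul_comm] }
  exact ⟨El.mkContinuous _ (fun F => (key F).2), fun F => rfl⟩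
end conv

theorem main_adm {A : Type*} [NormedRing A] [NormedAlgebra ℂ A] [CompleteSpace A]
    [NormOneClass A] (p q : ℝ) (hpq : p.HolderConjugate q) (ω : ℤ → ℝ) (hw : IsWeight ω)
    (hconv : ∀ n : ℤ, (∑' k : ℤ, ω k ^ (-q) * ω (n - k) ^ (-q)) ≤ ω n ^ (-q))
    (hsum : Summable fun n : ℤ => ω n ^ (-q))
    (hgr : ∀ r : ℝ, 1 < r → ∃ C : ℝ, ∀ n : ℤ, ω n ≤ C * r ^ n.natAbs)
    (f : ℤ → A) (hf : Summable fun n : ℤ => ‖f n‖ ^ p * ω n ^ p)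
    (hinv : ∀ z : ℂ, ‖z‖ = 1 → IsUnit (∑' n : ℤ, z ^ n • f n)) :
    ∃ g : ℤ → A,
        (Summable fun n : ℤ => ‖g n‖ ^ p * ω n ^ p) ∧
        (∀ n : ℤ, (∑' m : ℤ, f m * g (n - m)) = if n = 0 then 1 else 0) ∧
        (∀ n : ℤ, (∑' m : ℤ, g m * f (n - m)) = if n = 0 then 1 else 0) := by
  obtain ⟨P, hP1, hPtop, rfl⟩ : ∃ P : ℝ≥0∞, 1 ≤ P ∧ P ≠ ⊤ ∧ P.toReal = p :=
    ⟨ENNReal.ofReal p, by simpa using hpq.lt.le, ENNReal.ofReal_ne_top,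
      ENNReal.toReal_ofReal hpq.pos.le⟩
  have hfact : Fact (1 ≤ P) := ⟨hP1⟩
  have hPpos : 0 < P := zero_lt_one.trans_le hP1
  have hp0 := hpq.pos
  have hq0 := hpq.symm.pos
  have w1 := hw.1
  have wpos : ∀ n, 0 < ω n := fun n => zero_lt_one.trans_le (w1 n)
  have wne : ∀ n, (ω n : ℂ) ≠ 0 := fun n => by exact_mod_cast (wpos n).ne'
  set c : ℤ → ℤ → ℝ := fun n m => ω n / (ω m * ω (n - m)) with hc
  have hc0 : ∀ n m, 0 ≤ c n m := fun n m =>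
    div_nonneg (wpos n).le (mul_nonneg (wpos _).le (wpos _).le)
  have hcq : ∀ n m, c n m ^ q = ω n ^ q * (ω m ^ (-q) * ω (n - m) ^ (-q)) := by
    intro n m
    rw [hc, Real.div_rpow (wpos n).le (mul_nonneg (wpos _).le (wpos _).le),
      Real.mul_rpow (wpos _).le (wpos _).le, Real.rpow_neg (wpos _).le, Real.rpow_neg (wpos _).le,
      div_eq_mul_inv, mul_inv]
  have hs0 : ∀ n, Summable fun k : ℤ => ω k ^ (-q) * ω (n - k) ^ (-q) := by
    intro n
    refine Summable.of_nonneg_of_le (fun k => ?_) (fun k => ?_) hsum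
    · exact mul_nonneg (Real.rpow_nonneg (wpos _).le _) (Real.rpow_nonneg (wpos _).le _)
    · exact mul_le_of_le_one_right (Real.rpow_nonneg (wpos _).le _)
        (Real.rpow_le_one_of_one_le_of_nonpos (w1 _) (by linarith))
  have hcs : ∀ n, Summable fun m => c n m ^ q := by
    intro n; simp only [hcq]; exact (hs0 n).mul_left _
  have hc1 : ∀ n, ∑' m, c n m ^ q ≤ 1 := by
    intro n
    simp only [hcq]
    rw [tsum_mul_left]
    calc _ ≤ ω n ^ q * ω n ^ (-q) := by
          gcongr
          · exact Real.rpow_nonneg (wpos n).le _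
          · exact hconv n
      _ = 1 := by rw [← Real.rpow_add (wpos n)]; simp
  obtain ⟨M, hMn, hM⟩ := exists_conv (A := A) hpq c hc0 hcs hc1
  let S : ℤ → A →L[ℂ] lp (fun _ : ℤ => A) P := fun i =>
    (ω i : ℂ) • lp.singleContinuousLinearMap ℂ (fun _ : ℤ => A) P i
  have hS : ∀ i a, S i a = lp.single P i ((ω i : ℂ) • a) := by
    intro i a
    rw [lp.single_smul]; rfl
  have hSapp : ∀ i a n, S i a n = if n = i then (ω i : ℂ) • a else 0 := by
    intro i a n
    rw [hS, lp.single_apply, Pi.single_apply]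
  have hsing : ∀ i a, lp.single P i a = S i ((ω i : ℂ)⁻¹ • a) := by
    intro i a
    rw [hS, smul_inv_smul₀ (wne i)]
  have hMS : ∀ i j a b, M (S i a) (S j b) = S (i + j) (a * b) := by
    intro i j a b
    ext n
    rw [hM, hSapp]
    rw [tsum_eq_single i (by intro m hm; rw [hSapp, if_neg hm, zero_mul, smul_zero])]
    rw [hSapp, hSapp, if_pos rfl]
    by_cases h : n = i + j
    · have h' : n - i = j := by omega
      rw [if_pos h, if_pos h', smul_mul_smul_comm, smul_smul, hc]
      dsimp only
      rw [h', ← h]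
      congr 1
      have := wne i; have := wne j
      push_cast
      field_simp
    · have h' : ¬ (n - i = j) := by omega
      rw [if_neg h, if_neg h', mul_zero, smul_zero]
  have hext : ∀ {Y : Type _} [NormedAddCommGroup Y] [NormedSpace ℂ Y]
      (Φ Ψ : lp (fun _ : ℤ => A) P →L[ℂ] Y) (_ : ∀ i a, Φ (S i a) = Ψ (S i a)) (F), Φ F = Ψ F := by
    intro Y _ _ Φ Ψ h F
    refine lp_clm_ext hPtop Φ Ψ (fun i a => ?_) F
    rw [hsing, h]
  have hone : ∀ F, M (S 0 1) F = F := by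
    intro F
    refine hext (M (S 0 1)) (ContinuousLinearMap.id ℂ _) (fun i a => ?_) F
    rw [hMS]; simp
  have hone' : ∀ F, M F (S 0 1) = F := by
    intro F
    refine hext (M.flip (S 0 1)) (ContinuousLinearMap.id ℂ _) (fun i a => ?_) F
    rw [ContinuousLinearMap.flip_apply, hMS]; simp
  have hassoc : ∀ F G H, M (M F G) H = M F (M G H) := by
    intro F G H
    refine hext ((M.flip H).comp (M.flip G)) (M.flip (M G H)) (fun i a => ?_) F
    change M (M (S i a) G) H = M (S i a) (M G H)
    refine hext ((M.flip H).comp (M (S i a))) ((M (S i a)).comp (M.flip H)) (fun j b => ?_) G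
    change M (M (S i a) (S j b)) H = M (S i a) (M (S j b) H)
    refine hext (M (M (S i a) (S j b))) ((M (S i a)).comp (M (S j b))) (fun k d => ?_) H
    change M (M (S i a) (S j b)) (S k d) = M (S i a) (M (S j b) (S k d))
    simp only [hMS, add_assoc, mul_assoc]
  have hcent : ∀ n F, M (S n 1) F = M F (S n 1) := by
    intro n F
    refine hext (M (S n 1)) (M.flip (S n 1)) (fun i a => ?_) F
    rw [ContinuousLinearMap.flip_apply, hMS, hMS, add_comm, one_mul, mul_one]
  -- evaluation
  have heval : ∀ z : ℂ, ‖z‖ = 1 → ∃ E : lp (fun _ : ℤ => A) P →L[ℂ] A,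
      (∀ F, E F = ∑' n : ℤ, z ^ n • ((ω n : ℂ)⁻¹ • F n)) ∧
      (E (S 0 1) = 1) ∧ ∀ F G, E (M F G) = E F * E G := by
    intro z hz
    have hz0 : z ≠ 0 := by rintro rfl; simp at hz
    obtain ⟨-, E, hE⟩ := exists_eval (A := A) hpq (fun n : ℤ => z ^ n * (ω n : ℂ)⁻¹) (by
      refine hsum.congr fun n => ?_
      rw [norm_mul, norm_zpow, hz, one_zpow, one_mul, norm_inv, Complex.norm_real,
        Real.norm_of_nonneg (wpos n).le, Real.rpow_neg (wpos n).le, Real.inv_rpow (wpos n).le])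
    have hES : ∀ i a, E (S i a) = z ^ i • a := by
      intro i a
      rw [hE, tsum_eq_single i (by intro m hm; rw [hSapp, if_neg hm, smul_zero]), hSapp,
        if_pos rfl, smul_smul, mul_assoc, inv_mul_cancel₀ (wne i), mul_one]
    refine ⟨E, fun F => by rw [hE]; simp only [mul_smul], by rw [hES]; simp, ?_⟩
    intro F G
    refine hext (E.comp (M.flip G)) (((ContinuousLinearMap.mul ℂ A).flip (E G)).comp E)
      (fun i a => ?_) F
    change E (M (S i a) G) = E (S i a) * E G
    refine hext (E.comp (M (S i a))) (((ContinuousLinearMap.mul ℂ A) (E (S i a))).comp E)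
      (fun j b => ?_) G
    change E (M (S i a) (S j b)) = E (S i a) * E (S j b)
    rw [hMS, hES, hES, hES, smul_mul_smul_comm, zpow_add₀ hz0]
  letI ring : NormedRing (lp (fun _ : ℤ => A) P) :=
    { (inferInstance : NormedAddCommGroup (lp (fun _ : ℤ => A) P)) with
      mul := fun F G => M F G
      one := S 0 1
      left_distrib := fun F G H => map_add (M F) G H
      right_distrib := fun F G H => by
        change M (F + G) H = M F H + M G H
        rw [map_add]; rfl
      zero_mul := fun F => by
        change M 0 F = 0
        rw [map_zero]; rfl
      mul_zero := fun F => map_zero (M F)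
      mul_assoc := hassoc
      one_mul := hone
      mul_one := hone'
      norm_mul_le := hMn }
  have hmul : ∀ F G : lp (fun _ : ℤ => A) P, F * G = M F G := fun _ _ => rfl
  have hone1 : (1 : lp (fun _ : ℤ => A) P) = S 0 1 := rfl
  have ist : IsScalarTower ℂ (lp (fun _ : ℤ => A) P) (lp (fun _ : ℤ => A) P) :=
    ⟨fun z F G => by
      change M (z • F) G = z • M F G
      rw [map_smul]; rfl⟩
  have scc : SMulCommClass ℂ (lp (fun _ : ℤ => A) P) (lp (fun _ : ℤ => A) P) :=
    ⟨fun z F G => (map_smul (M F) z G).symm⟩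
  have hleft : ∀ F : lp (fun _ : ℤ => A) P,
      (∀ z : ℂ, ‖z‖ = 1 → ∃ a : A, a * (∑' n : ℤ, z ^ n • ((ω n : ℂ)⁻¹ • F n)) = 1) →
      ∃ h, h * F = 1 := by
    intro F hF
    refine left_inv_aux (S 0) (fun a b => ?_) rfl (fun n => S n 1) rfl (fun m n => ?_)
      hcent ?_ (fun n => (ω n : ℂ)⁻¹ • F n) F ?_ ?_ hF
    · rw [hmul, hMS, add_zero]
    · rw [hmul, hMS, one_mul]
    · intro r hr
      obtain ⟨C, hC⟩ := hgr r hr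
      refine ⟨C, fun n => ?_⟩
      rw [hS, lp.norm_single hPpos, norm_smul, norm_one, mul_one, Complex.norm_real,
        Real.norm_of_nonneg (wpos n).le]
      exact hC n
    · have : (fun n => S 0 ((ω n : ℂ)⁻¹ • F n) * S n 1) = fun n => lp.single P n (F n) := by
        funext n
        rw [hmul, hMS, zero_add, mul_one, hsing]
      rw [this]
      exact lp.hasSum_single hPtop F
    · refine (exists_eval (A := A) hpq (fun n : ℤ => (ω n : ℂ)⁻¹) ?_).1 F
      refine hsum.congr fun n => ?_
      rw [norm_inv, Complex.norm_real,
        Real.norm_of_nonneg (wpos n).le, Real.rpow_neg (wpos n).le, Real.inv_rpow (wpos n).le]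
  -- the element
  have hnf : ∀ n, ‖(ω n : ℂ) • f n‖ ^ P.toReal = ‖f n‖ ^ P.toReal * ω n ^ P.toReal := by
    intro n
    rw [norm_smul, Complex.norm_real, Real.norm_of_nonneg (wpos n).le, mul_comm,
      Real.mul_rpow (norm_nonneg _) (wpos n).le]
  let F : lp (fun _ : ℤ => A) P := ⟨fun n => (ω n : ℂ) • f n, memℓp_gen (by
    simp only [hnf]; exact hf)⟩
  have hFn : ∀ n, F n = (ω n : ℂ) • f n := fun _ => rfl
  have hFf : ∀ n, (ω n : ℂ)⁻¹ • F n = f n := fun n => by rw [hFn, inv_smul_smul₀ (wne n)]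
  obtain ⟨H, hHF⟩ := hleft F (by
    intro z hz
    simp only [hFf]
    obtain ⟨u, hu⟩ := hinv z hz
    exact ⟨↑u⁻¹, by rw [← hu]; simp⟩)
  obtain ⟨K, hKH⟩ := hleft H (by
    intro z hz
    obtain ⟨E, hE, hE1, hEm⟩ := heval z hz
    rw [← hE]
    have h1 : E H * E F = 1 := by rw [← hEm, ← hE1]; exact congrArg E hHF
    obtain ⟨u, hu⟩ := hinv z hz
    have h2 : E F = u := by rw [hE, hu]; simp only [hFf]
    rw [h2] at h1
    refine ⟨u, ?_⟩
    have : E H = ↑u⁻¹ := by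
      rw [← mul_one (E H), ← u.mul_inv, ← mul_assoc, h1, one_mul]
    rw [this]; simp)
  have hFH : F * H = 1 := by
    have : K = F := by
      calc K = K * (H * F) := by rw [hHF, mul_one]
        _ = F := by rw [← mul_assoc, hKH, one_mul]
    rw [← this]; exact hKH
  have hfin : ∀ F G : lp (fun _ : ℤ => A) P, F * G = 1 → ∀ n : ℤ,
      ∑' m, ((ω m : ℂ)⁻¹ • F m) * ((ω (n - m) : ℂ)⁻¹ • G (n - m)) = if n = 0 then 1 else 0 := by
    intro F G h n
    have h1 : M F G n = S 0 1 n := by rw [← hmul, h]; rfl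
    rw [hM, hSapp] at h1
    have h2 : ∀ m, (c n m : ℂ) • (F m * G (n - m)) = (ω n : ℂ) •
        (((ω m : ℂ)⁻¹ • F m) * ((ω (n - m) : ℂ)⁻¹ • G (n - m))) := by
      intro m
      rw [smul_mul_smul_comm, smul_smul, hc]
      congr 1
      push_cast
      rw [div_eq_mul_inv, mul_inv]
    simp only [h2] at h1
    rw [tsum_const_smul''] at h1
    apply smul_right_injective A (wne n)
    dsimp only
    rw [h1]
    by_cases h0 : n = 0
    · simp [h0]
    · simp [h0]
  refine ⟨fun n => (ω n : ℂ)⁻¹ • H n, ?_, ?_, ?_⟩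
  · refine (lp.hasSum_norm hp0 H).summable.congr fun n => ?_
    rw [← Real.mul_rpow (norm_nonneg _) (wpos n).le, norm_smul, norm_inv, Complex.norm_real,
      Real.norm_of_nonneg (wpos n).le]
    congr 1
    have := (wpos n).ne'
    field_simp
  · intro n
    have := hfin F H hFH n
    simp only [hFf] at this
    exact this
  · intro n
    have := hfin H F hHF n
    simp only [hFf] at this
    exact this

theorem rho2_one_aux {ω : ℤ → ℝ} (hw : IsWeight ω) (h : rho2 ω = 1) (r : ℝ) (hr : 1 < r) :
    ∃ n : ℕ, 0 < n ∧ ω (n : ℤ) ≤ r ^ n := by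
  have hr' : rho2 ω < r := by rw [h]; exact hr
  unfold rho2 at hr'
  have hne : {x : ℝ | ∃ n : ℕ, 0 < n ∧ x = ω (n : ℤ) ^ ((1 : ℝ) / (n : ℝ))}.Nonempty := ⟨_, 1, one_pos, rfl⟩
  obtain ⟨x, ⟨n, hn, rfl⟩, hx⟩ := exists_lt_of_csInf_lt hne hr'
  refine ⟨n, hn, ?_⟩
  have h0 : 0 ≤ ω n := zero_le_one.trans (hw.1 _)
  calc ω n = (ω n ^ ((1 : ℝ) / n)) ^ n := by
        rw [one_div, Real.rpow_inv_natCast_pow h0 hn.ne']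
    _ ≤ r ^ n := by
        have := Real.rpow_nonneg h0 ((1 : ℝ) / n)
        gcongr

theorem rho1_one_aux {ω : ℤ → ℝ} (hw : IsWeight ω) (h : rho1 ω = 1) (r : ℝ) (hr : 1 < r) :
    ∃ n : ℕ, 0 < n ∧ ω (-(n : ℤ)) ≤ r ^ n := by
  have hr' : r⁻¹ < rho1 ω := by rw [h]; exact inv_lt_one_of_one_lt₀ hr
  unfold rho1 at hr'
  have hne : {x : ℝ | ∃ n : ℕ, 0 < n ∧ x = ω (-(n : ℤ)) ^ (-(1 : ℝ) / (n : ℝ))}.Nonempty := ⟨_, 1, one_pos, rfl⟩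
  obtain ⟨x, ⟨n, hn, rfl⟩, hx⟩ := exists_lt_of_lt_csSup hne hr'
  refine ⟨n, hn, ?_⟩
  have h1 : 0 < ω (-(n : ℤ)) := zero_lt_one.trans_le (hw.1 _)
  have h0 := h1.le
  have hpos : 0 < ω (-(n : ℤ)) ^ ((1 : ℝ) / n) := Real.rpow_pos_of_pos h1 _
  rw [neg_div, Real.rpow_neg h0, inv_lt_inv₀ (by linarith) hpos] at hx
  calc ω (-(n : ℤ)) = (ω (-(n : ℤ)) ^ ((1 : ℝ) / n)) ^ n := by
        rw [one_div, Real.rpow_inv_natCast_pow h0 hn.ne']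
    _ ≤ r ^ n := by gcongr

theorem rho2_ne_aux {ω : ℤ → ℝ} (hw : IsWeight ω) (h : rho2 ω ≠ 1) :
    ∃ r : ℝ, 1 < r ∧ ∀ n : ℕ, r ^ n ≤ ω (n : ℤ) := by
  have h1 : ∀ x ∈ {x : ℝ | ∃ n : ℕ, 0 < n ∧ x = ω (n : ℤ) ^ ((1 : ℝ) / (n : ℝ))}, 1 ≤ x := by
    rintro x ⟨n, hn, rfl⟩
    exact Real.one_le_rpow (hw.1 _) (by positivity)
  have h2 : 1 ≤ rho2 ω := le_csInf ⟨_, 1, one_pos, rfl⟩ h1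
  refine ⟨rho2 ω, lt_of_le_of_ne h2 (Ne.symm h), fun n => ?_⟩
  rcases Nat.eq_zero_or_pos n with rfl | hn
  · simpa using hw.1 0
  · have h0 : 0 ≤ ω n := zero_le_one.trans (hw.1 _)
    have h3 : rho2 ω ≤ ω (n : ℤ) ^ ((1 : ℝ) / (n : ℝ)) := csInf_le ⟨1, h1⟩ ⟨n, hn, rfl⟩
    calc rho2 ω ^ n ≤ (ω n ^ ((1 : ℝ) / n)) ^ n := by gcongr
      _ = ω n := by rw [one_div, Real.rpow_inv_natCast_pow h0 hn.ne']

theorem rho1_ne_aux {ω : ℤ → ℝ} (hw : IsWeight ω) (h : rho1 ω ≠ 1) :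
    ∃ r : ℝ, 1 < r ∧ ∀ n : ℕ, r ^ n ≤ ω (-(n : ℤ)) := by
  have h1 : ∀ x ∈ {x : ℝ | ∃ n : ℕ, 0 < n ∧ x = ω (-(n : ℤ)) ^ (-(1 : ℝ) / (n : ℝ))}, x ≤ 1 := by
    rintro x ⟨n, hn, rfl⟩
    refine Real.rpow_le_one_of_one_le_of_nonpos (hw.1 _) ?_
    rw [neg_div]
    have : (0 : ℝ) ≤ 1 / n := by positivity
    linarith
  have h2 : rho1 ω ≤ 1 := csSup_le ⟨_, 1, one_pos, rfl⟩ h1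
  have h2' : rho1 ω < 1 := lt_of_le_of_ne h2 h
  have hle : ∀ n : ℕ, 0 < n → ω (-(n : ℤ)) ^ (-(1 : ℝ) / (n : ℝ)) ≤ rho1 ω := fun n hn =>
    le_csSup ⟨1, h1⟩ ⟨n, hn, rfl⟩
  have hpos : 0 < rho1 ω :=
    (Real.rpow_pos_of_pos (zero_lt_one.trans_le (hw.1 _)) _).trans_le (hle 1 one_pos)
  refine ⟨(rho1 ω)⁻¹, (one_lt_inv₀ hpos).mpr h2', fun n => ?_⟩
  rcases Nat.eq_zero_or_pos n with rfl | hn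
  · simpa using hw.1 0
  · have h1 : 0 < ω (-(n : ℤ)) := zero_lt_one.trans_le (hw.1 _)
    have h0 := h1.le
    have hpos' : 0 < ω (-(n : ℤ)) ^ ((1 : ℝ) / n) := Real.rpow_pos_of_pos h1 _
    have h3 := hle n hn
    rw [neg_div, Real.rpow_neg h0, inv_le_comm₀ hpos' hpos] at h3
    calc (rho1 ω)⁻¹ ^ n ≤ (ω (-(n : ℤ)) ^ ((1 : ℝ) / n)) ^ n := by gcongr
      _ = ω (-(n : ℤ)) := by rw [one_div, Real.rpow_inv_natCast_pow h0 hn.ne']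

theorem growth_aux (u : ℕ → ℝ) (hu1 : ∀ n, 1 ≤ u n) (hum : ∀ m n, u (m + n) ≤ u m * u n)
    (hr : ∀ r : ℝ, 1 < r → ∃ n : ℕ, 0 < n ∧ u n ≤ r ^ n) (r : ℝ) (hr1 : 1 < r) :
    ∃ C : ℝ, 0 < C ∧ ∀ n, u n ≤ C * r ^ n := by
  obtain ⟨N, hN, hNr⟩ := hr r hr1
  have hpos : ∀ n, 0 ≤ u n := fun n => zero_le_one.trans (hu1 n)
  have hr0 : 0 < r := by linarith
  have key : ∀ k j, u (N * k + j) ≤ (r ^ N) ^ k * u j := by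
    intro k j
    induction k with
    | zero => simp
    | succ k ih =>
      have : N * (k + 1) + j = N + (N * k + j) := by ring
      rw [this, pow_succ', mul_assoc]
      refine (hum _ _).trans (mul_le_mul hNr ih (hpos _) (by positivity))
  refine ⟨∑ j ∈ Finset.range N, u j, ?_, fun n => ?_⟩
  · refine Finset.sum_pos (fun i _ => zero_lt_one.trans_le (hu1 i)) ⟨0, by simpa using hN⟩
  · have h1 := key (n / N) (n % N)
    rw [Nat.div_add_mod] at h1
    have h2 : u (n % N) ≤ ∑ j ∈ Finset.range N, u j :=
      Finset.single_le_sum (f := u) (fun i _ => hpos i) (Finset.mem_range.mpr (Nat.mod_lt _ hN))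
    have h3 : (r ^ N) ^ (n / N) ≤ r ^ n := by
      rw [← pow_mul]
      exact pow_le_pow_right₀ hr1.le (Nat.mul_div_le n N)
    calc u n ≤ (r ^ N) ^ (n / N) * u (n % N) := h1
      _ ≤ r ^ n * ∑ j ∈ Finset.range N, u j := by
        gcongr
        exact hpos _
      _ = _ := mul_comm _ _

theorem sym_aux (q : ℝ) (hq : 0 < q) (u : ℕ → ℝ) (hu1 : ∀ n, 1 ≤ u n)
    (hum : ∀ m n, u (m + n) ≤ u m * u n) (K D : ℝ) (hK : 1 ≤ K)
    (hmono : ∀ n k, u n ≤ K * u (n + k))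
    (hs : Summable fun n => u n ^ (-q))
    (hD : ∀ n, ∑ k ∈ Finset.range (n + 1), u k ^ (-q) * u (n - k) ^ (-q) ≤ D * u n ^ (-q)) :
    ∃ C : ℝ, 0 < C ∧ IsAMAW q (fun n : ℤ => C * u n.natAbs) := by
  have upos : ∀ n, 0 < u n := fun n => zero_lt_one.trans_le (hu1 n)
  set v : ℕ → ℝ := fun n => u n ^ (-q) with hv
  have vpos : ∀ n, 0 < v n := fun n => Real.rpow_pos_of_pos (upos n) _
  have v1 : ∀ n, v n ≤ 1 := fun n =>
    Real.rpow_le_one_of_one_le_of_nonpos (hu1 n) (by linarith)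
  have hK0 : 0 < K := by linarith
  have vmono : ∀ n m, n ≤ m → v m ≤ K ^ q * v n := by
    intro n m hnm
    obtain ⟨k, rfl⟩ := Nat.exists_eq_add_of_le hnm
    have h1 := hmono n k
    simp only [hv]
    have h2 : (K * u (n + k)) ^ (-q) ≤ u n ^ (-q) :=
      Real.rpow_le_rpow_of_nonpos (upos n) h1 (by linarith)
    rw [Real.mul_rpow hK0.le (upos _).le] at h2
    calc u (n + k) ^ (-q) = K ^ q * (K ^ (-q) * u (n + k) ^ (-q)) := by
          rw [← mul_assoc, ← Real.rpow_add hK0]; simp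
      _ ≤ _ := by gcongr
  have hsZ : Summable fun k : ℤ => v k.natAbs := by
    apply Summable.of_nat_of_neg
    · simpa using hs
    · simpa using hs
  set T₀ : ℝ := ∑' k : ℤ, v k.natAbs with hT
  have hT0 : 0 ≤ T₀ := tsum_nonneg fun k => (vpos _).le
  have hsZn : ∀ n : ℤ, HasSum (fun k : ℤ => v (n - k).natAbs) T₀ := by
    intro n
    exact ((Equiv.subLeft n).hasSum_iff (f := fun k : ℤ => v k.natAbs)).mpr hsZ.hasSum
  have hD0 : 0 ≤ D := by
    have h := hD 0
    have h2 : 0 ≤ ∑ k ∈ Finset.range (0 + 1), u k ^ (-q) * u (0 - k) ^ (-q) :=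
      Finset.sum_nonneg fun k _ => mul_nonneg (vpos _).le (vpos _).le
    by_contra hneg
    push Not at hneg
    have := mul_neg_of_neg_of_pos hneg (vpos 0)
    simp only [hv] at this
    linarith
  set M : ℝ := 2 * K ^ q * T₀ + D with hM
  have hM0 : 0 ≤ M := by positivity
  -- the key convolution estimate
  have hcs : ∀ n : ℤ, Summable fun k : ℤ => v k.natAbs * v (n - k).natAbs := by
    intro n
    exact Summable.of_nonneg_of_le (fun k => mul_nonneg (vpos _).le (vpos _).le)
      (fun k => mul_le_of_le_one_right (vpos _).le (v1 _)) hsZ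
  have hconv : ∀ n : ℤ, ∑' k : ℤ, v k.natAbs * v (n - k).natAbs ≤ M * v n.natAbs := by
    intro n
    set N := n.natAbs with hN
    let w : ℤ → ℝ := fun k => if k.natAbs + (n - k).natAbs = N then
      v k.natAbs * v (n - k).natAbs else 0
    let e : ℕ → ℤ := fun j => if 0 ≤ n then (j : ℤ) else -(j : ℤ)
    have einj : Function.Injective e := by
      intro i j hij
      simp only [e] at hij
      split_ifs at hij <;> omega
    have hw : HasSum w (∑ k ∈ Finset.range (N + 1), v k * v (N - k)) := by
      have h1 : HasSum w (∑ b ∈ (Finset.range (N + 1)).image e, w b) := by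
        apply hasSum_sum_of_ne_finset_zero
        intro b hb
        simp only [w]
        rw [if_neg]
        intro h
        apply hb
        rw [Finset.mem_image]
        refine ⟨b.natAbs, Finset.mem_range.mpr (by omega), ?_⟩
        simp only [e]
        split_ifs <;> omega
      rw [Finset.sum_image (fun x _ y _ h => einj h)] at h1
      convert h1 using 1
      apply Finset.sum_congr rfl
      intro k hk
      rw [Finset.mem_range] at hk
      have h2 : (e k).natAbs = k := by simp only [e]; split_ifs <;> omega
      have h3 : (n - e k).natAbs = N - k := by simp only [e]; split_ifs <;> omega
      simp only [w]
      rw [h2, h3, if_pos (by omega)]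
    have hbig := ((hsZ.hasSum.add (hsZn n)).mul_left (K ^ q * v N)).add hw
    have hle : ∀ k : ℤ, v k.natAbs * v (n - k).natAbs ≤
        K ^ q * v N * (v k.natAbs + v (n - k).natAbs) + w k := by
      intro k
      have hKq : 0 < K ^ q := Real.rpow_pos_of_pos hK0 _
      have p1 := vpos k.natAbs
      have p2 := vpos (n - k).natAbs
      have p3 := vpos N
      by_cases h : k.natAbs + (n - k).natAbs = N
      · simp only [w, if_pos h]
        have : 0 ≤ K ^ q * v N * (v k.natAbs + v (n - k).natAbs) := by positivity
        linarith
      · simp only [w, if_neg h, add_zero]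
        rcases (by omega : N ≤ k.natAbs ∨ N ≤ (n - k).natAbs) with h' | h'
        · have := mul_le_mul_of_nonneg_right (vmono _ _ h') p2.le
          have h4 : 0 ≤ K ^ q * v N * v k.natAbs := by positivity
          linarith
        · have := mul_le_mul_of_nonneg_left (vmono _ _ h') p1.le
          have h4 : 0 ≤ K ^ q * v N * v (n - k).natAbs := by positivity
          linarith
    have h5 := hasSum_le hle (hcs n).hasSum hbig
    have h6 := hD N
    refine h5.trans ?_
    simp only [hM]
    have h7 : ∑ k ∈ Finset.range (N + 1), v k * v (N - k) ≤ D * v N := h6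
    rw [← hT]
    linarith
  -- the constant
  have hM1 : 0 < 1 + M := by linarith
  set C : ℝ := K * (1 + M) ^ (1 / q) with hC
  have hone : 1 ≤ (1 + M) ^ (1 / q) := Real.one_le_rpow (by linarith) (by positivity)
  have hCK : K ≤ C := by rw [hC]; nlinarith
  have hC1 : 1 ≤ C := hK.trans hCK
  have hC0 : 0 < C := by linarith
  have hCq : M ≤ C ^ q := by
    rw [hC, Real.mul_rpow hK0.le (by positivity), ← Real.rpow_mul hM1.le, one_div,
      inv_mul_cancel₀ hq.ne', Real.rpow_one]
    have : 1 ≤ K ^ q := Real.one_le_rpow hK hq.le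
    nlinarith
  have hCv : ∀ n, (C * u n) ^ (-q) = C ^ (-q) * v n := fun n =>
    Real.mul_rpow hC0.le (upos n).le
  have hcc : C ^ (-q) * M ≤ 1 := by
    rw [Real.rpow_neg hC0.le, inv_mul_le_iff₀ (Real.rpow_pos_of_pos hC0 _), mul_one]
    exact hCq
  have hCqpos : 0 < C ^ (-q) := Real.rpow_pos_of_pos hC0 _
  have hmono' : ∀ n m, n ≤ m → C * u n ≤ K * (C * u m) := by
    intro n m h
    obtain ⟨k, rfl⟩ := Nat.exists_eq_add_of_le h
    have := mul_le_mul_of_nonneg_left (hmono n k) hC0.le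
    linarith
  refine ⟨C, hC0, ⟨fun n => ?_, fun m n => ?_⟩, fun n => ?_, ?_, fun _ => ⟨K, hK0, ?_⟩,
    fun _ => ⟨K, hK0, ?_⟩⟩
  · have := hu1 n.natAbs
    dsimp only
    nlinarith
  · dsimp only
    have hle : (m + n).natAbs ≤ m.natAbs + n.natAbs := Int.natAbs_add_le m n
    obtain ⟨k, hk⟩ := Nat.exists_eq_add_of_le hle
    have h1 := hmono (m + n).natAbs k
    rw [← hk] at h1
    have h2 : u (m + n).natAbs ≤ C * (u m.natAbs * u n.natAbs) := by
      refine h1.trans ?_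
      have := hum m.natAbs n.natAbs
      have h0 := (upos (m.natAbs + n.natAbs)).le
      exact mul_le_mul hCK this h0 hC0.le
    calc C * u (m + n).natAbs ≤ C * (C * (u m.natAbs * u n.natAbs)) := by gcongr
      _ = _ := by ring
  · simp only [hCv]
    have : ∀ k : ℤ, C ^ (-q) * v k.natAbs * (C ^ (-q) * v (n - k).natAbs) =
        C ^ (-q) * C ^ (-q) * (v k.natAbs * v (n - k).natAbs) := fun k => by ring
    simp only [this]
    rw [tsum_mul_left]
    calc _ ≤ C ^ (-q) * C ^ (-q) * (M * v n.natAbs) := by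
          gcongr
          exact hconv n
      _ = (C ^ (-q) * M) * (C ^ (-q) * v n.natAbs) := by ring
      _ ≤ 1 * (C ^ (-q) * v n.natAbs) := by
          gcongr
          exact mul_nonneg hCqpos.le (vpos _).le
      _ = _ := one_mul _
  · simp only [hCv]
    exact hsZ.mul_left _
  · intro n k hn hk
    exact hmono' _ _ (by omega)
  · intro n k hn hk
    exact hmono' _ _ (by omega)

theorem poly_aux (q : ℝ) (hq : 1 < q) :
    (Summable fun n : ℕ => (((n : ℝ) + 1) ^ 2) ^ (-q)) ∧
    ∃ D : ℝ, ∀ n : ℕ, ∑ k ∈ Finset.range (n + 1),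
      (((k : ℝ) + 1) ^ 2) ^ (-q) * ((((n - k : ℕ) : ℝ) + 1) ^ 2) ^ (-q)
      ≤ D * (((n : ℝ) + 1) ^ 2) ^ (-q) := by
  set v : ℕ → ℝ := fun n => (((n : ℝ) + 1) ^ 2) ^ (-q) with hv
  have vpos : ∀ n, 0 < v n := fun n => Real.rpow_pos_of_pos (by positivity) _
  have hs : Summable v := by
    have h1 : Summable fun n : ℕ => ((((n + 1 : ℕ) : ℝ)) ^ 2)⁻¹ :=
      (summable_nat_add_iff 1).mpr (Real.summable_nat_pow_inv.mpr one_lt_two)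
    refine Summable.of_nonneg_of_le (fun n => (vpos n).le) (fun n => ?_) h1
    rw [← Real.rpow_neg_one]
    push_cast
    refine Real.rpow_le_rpow_of_exponent_le ?_ (by linarith)
    have : (0 : ℝ) ≤ n := by positivity
    nlinarith
  have hdbl : ∀ n a : ℕ, n + 1 ≤ 2 * (a + 1) → v a ≤ 4 ^ q * v n := by
    intro n a h
    have h' : (n : ℝ) + 1 ≤ 2 * (a + 1) := by exact_mod_cast h
    have h1 : ((n : ℝ) + 1) ^ 2 ≤ 4 * ((a : ℝ) + 1) ^ 2 := by
      have : (0 : ℝ) ≤ n := by positivity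
      nlinarith
    have h2 := Real.rpow_le_rpow_of_nonpos (by positivity) h1 (by linarith : -q ≤ 0)
    rw [Real.mul_rpow (by norm_num) (by positivity)] at h2
    calc v a = 4 ^ q * (4 ^ (-q) * v a) := by
          rw [← mul_assoc, ← Real.rpow_add (by norm_num)]; simp
      _ ≤ _ := by
          gcongr
  refine ⟨hs, 2 * 4 ^ q * ∑' n, v n, fun n => ?_⟩
  have h4 : (0 : ℝ) < 4 ^ q := by positivity
  have hle : ∀ k ∈ Finset.range (n + 1), v k * v (n - k) ≤ 4 ^ q * v n * (v k + v (n - k)) := by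
    intro k hk
    rw [Finset.mem_range] at hk
    have p1 := vpos k
    have p2 := vpos (n - k)
    have p3 := vpos n
    rcases (by omega : n + 1 ≤ 2 * (k + 1) ∨ n + 1 ≤ 2 * ((n - k) + 1)) with h | h
    · have := mul_le_mul_of_nonneg_right (hdbl _ _ h) p2.le
      have h5 : 0 ≤ 4 ^ q * v n * v k := by positivity
      linarith
    · have := mul_le_mul_of_nonneg_left (hdbl _ _ h) p1.le
      have h5 : 0 ≤ 4 ^ q * v n * v (n - k) := by positivity
      linarith
  calc ∑ k ∈ Finset.range (n + 1), v k * v (n - k)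
      ≤ ∑ k ∈ Finset.range (n + 1), 4 ^ q * v n * (v k + v (n - k)) := Finset.sum_le_sum hle
    _ = 4 ^ q * v n * (2 * ∑ k ∈ Finset.range (n + 1), v k) := by
        rw [← Finset.mul_sum, Finset.sum_add_distrib, Finset.sum_flip v, two_mul]
    _ ≤ 4 ^ q * v n * (2 * ∑' k, v k) := by
        have := hs.sum_le_tsum (Finset.range (n + 1)) (fun i _ => (vpos i).le)
        have := (vpos n).le
        gcongr
    _ = _ := by ring

theorem poly_growth (r : ℝ) (hr : 1 < r) : ∃ n : ℕ, 0 < n ∧ ((n : ℝ) + 1) ^ 2 ≤ r ^ n := by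
  have h := tendsto_pow_const_div_const_pow_of_one_lt 2 hr
  have h1 := h.eventually (gt_mem_nhds (by norm_num : (0 : ℝ) < 1 / 4))
  obtain ⟨n, hn, hn1⟩ := (h1.and (Filter.eventually_ge_atTop 1)).exists
  refine ⟨n, hn1, ?_⟩
  rw [div_lt_iff₀ (by positivity)] at hn
  have : (1 : ℝ) ≤ n := by exact_mod_cast hn1
  nlinarith

theorem finish_aux {A : Type*} [NormedRing A] [NormedAlgebra ℂ A] [CompleteSpace A]
    [NormOneClass A]
    (p q : ℝ) (hpq : p.HolderConjugate q)
    (ω : ℤ → ℝ) (hω : IsWeight ω)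
    (f : ℤ → A) (hf : Summable fun n : ℤ => ‖f n‖ ^ p * ω n ^ p)
    (hinv : ∀ z : ℂ, ‖z‖ = 1 → IsUnit (∑' n : ℤ, z ^ n • f n))
    (u : ℕ → ℝ) (hu1 : ∀ n, 1 ≤ u n)
    (hum : ∀ m n, u (m + n) ≤ u m * u n) (K D : ℝ) (hK : 1 ≤ K)
    (hmono : ∀ n k, u n ≤ K * u (n + k))
    (hs : Summable fun n => u n ^ (-q))
    (hD : ∀ n, ∑ k ∈ Finset.range (n + 1), u k ^ (-q) * u (n - k) ^ (-q) ≤ D * u n ^ (-q))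
    (hgr : ∀ r : ℝ, 1 < r → ∃ C : ℝ, 0 < C ∧ ∀ n, u n ≤ C * r ^ n)
    (C₁ C₂ : ℝ) (h₁ : ∀ n : ℕ, u n ≤ C₁ * ω n) (h₂ : ∀ n : ℕ, u n ≤ C₂ * ω (-(n : ℤ))) :
    ∃ (ν : ℤ → ℝ) (g : ℤ → A), IsAMAW q ν ∧
        (∃ K > (0 : ℝ), ∀ n, 1 ≤ ν n ∧ ν n ≤ K * ω n) ∧
        (Summable fun n : ℤ => ‖g n‖ ^ p * ν n ^ p) ∧
        (∀ n : ℤ, (∑' m : ℤ, f m * g (n - m)) = if n = 0 then 1 else 0) ∧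
        (∀ n : ℤ, (∑' m : ℤ, g m * f (n - m)) = if n = 0 then 1 else 0) := by
  obtain ⟨C, hC, hν⟩ := sym_aux q hpq.symm.pos u hu1 hum K D hK hmono hs hD
  set ν : ℤ → ℝ := fun n => C * u n.natAbs with hνdef
  have wpos : ∀ n, 0 < ω n := fun n => zero_lt_one.trans_le (hω.1 n)
  have νpos : ∀ n, 0 < ν n := fun n => zero_lt_one.trans_le (hν.1.1 n)
  set L : ℝ := C * max 1 (max C₁ C₂) with hL
  have hL0 : 0 < L := mul_pos hC (lt_max_of_lt_left one_pos)
  have hle : ∀ n, ν n ≤ L * ω n := by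
    intro n
    have : u n.natAbs ≤ max 1 (max C₁ C₂) * ω n := by
      rcases Int.natAbs_eq n with h | h
      · calc u n.natAbs ≤ C₁ * ω n := by
              have := h₁ n.natAbs
              rwa [← h] at this
          _ ≤ _ := by
              have := (wpos n).le
              gcongr
              exact (le_max_left _ _).trans (le_max_right _ _)
      · calc u n.natAbs ≤ C₂ * ω n := by
              have := h₂ n.natAbs
              rwa [← h] at this
          _ ≤ _ := by
              have := (wpos n).le
              gcongr
              exact (le_max_right _ _).trans (le_max_right _ _)
    rw [hL, mul_assoc]
    exact mul_le_mul_of_nonneg_left this hC.le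
  have hfν : Summable fun n : ℤ => ‖f n‖ ^ p * ν n ^ p := by
    refine Summable.of_nonneg_of_le (fun n => ?_) (fun n => ?_) (hf.mul_left (L ^ p))
    · exact mul_nonneg (Real.rpow_nonneg (norm_nonneg _) _) (Real.rpow_nonneg (νpos n).le _)
    · have h1 : ν n ^ p ≤ (L * ω n) ^ p :=
        Real.rpow_le_rpow (νpos n).le (hle n) hpq.pos.le
      rw [Real.mul_rpow hL0.le (wpos n).le] at h1
      have := mul_le_mul_of_nonneg_left h1 (Real.rpow_nonneg (norm_nonneg (f n)) p)
      linarith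
  obtain ⟨g, hg⟩ := main_adm p q hpq ν hν.1 hν.2.1 hν.2.2.1 (by
    intro r hr
    obtain ⟨C', _, hC'⟩ := hgr r hr
    refine ⟨C * C', fun n => ?_⟩
    rw [mul_assoc]
    exact mul_le_mul_of_nonneg_left (hC' _) hC.le) f hfν hinv
  exact ⟨ν, g, hν, ⟨L, hL0, fun n => ⟨hν.1.1 n, hle n⟩⟩, hg⟩

theorem fin_conv_aux (q : ℝ) (hq : 0 < q) (ω : ℤ → ℝ) (hw : IsWeight ω)
    (hconv : ∀ n : ℤ, (∑' k : ℤ, ω k ^ (-q) * ω (n - k) ^ (-q)) ≤ ω n ^ (-q))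
    (hsum : Summable fun n : ℤ => ω n ^ (-q)) (e : ℕ → ℤ) (he : Function.Injective e)
    (hsub : ∀ n k : ℕ, k ≤ n → e (n - k) = e n - e k) (n : ℕ) :
    ∑ k ∈ Finset.range (n + 1), ω (e k) ^ (-q) * ω (e (n - k)) ^ (-q) ≤ 1 * ω (e n) ^ (-q) := by
  have wpos : ∀ n, 0 < ω n := fun n => zero_lt_one.trans_le (hw.1 n)
  have hs0 : Summable fun k : ℤ => ω k ^ (-q) * ω (e n - k) ^ (-q) := by
    refine Summable.of_nonneg_of_le (fun k => ?_) (fun k => ?_) hsum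
    · exact mul_nonneg (Real.rpow_nonneg (wpos _).le _) (Real.rpow_nonneg (wpos _).le _)
    · exact mul_le_of_le_one_right (Real.rpow_nonneg (wpos _).le _)
        (Real.rpow_le_one_of_one_le_of_nonpos (hw.1 _) (by linarith))
  rw [one_mul]
  refine le_trans ?_ (hconv (e n))
  refine le_trans (le_of_eq ?_) (hs0.sum_le_tsum ((Finset.range (n + 1)).image e) fun k _ =>
    mul_nonneg (Real.rpow_nonneg (wpos _).le _) (Real.rpow_nonneg (wpos _).le _))
  rw [Finset.sum_image (fun x _ y _ h => he h)]
  apply Finset.sum_congr rfl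
  intro k hk
  rw [hsub n k (by rw [Finset.mem_range] at hk; omega)]

/-- **Corollary 3.4.** Let `1 < p < ∞` with conjugate index `q`, `ω` an almost monotone
algebra weight on `ℤ`, `A` a unital Banach algebra, and `f ∈ ℓ^p(ℤ,ω,A)`.  If
`f̂(z) = ∑ f(n) zⁿ` is invertible in `A` for every `z ∈ 𝕋`, then there are an almost
monotone algebra weight `ν` with `1 ≤ ν ≤ Kω` for some `K > 0` and `g ∈ ℓ^p(ℤ,ν,A)` with
`f ⋆ g = g ⋆ f = δ₀`.  In particular, if `ω` is admissible then `g` can be taken in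
`ℓ^p(ℤ,ω,A)`. -/
theorem stmt11 {A : Type*} [NormedRing A] [NormedAlgebra ℂ A] [CompleteSpace A]
    [NormOneClass A]
    (p q : ℝ) (hp : 1 < p) (hpq : 1 / p + 1 / q = 1)
    (ω : ℤ → ℝ) (hω : IsAMAW q ω)
    (f : ℤ → A) (hf : Summable fun n : ℤ => ‖f n‖ ^ p * ω n ^ p)
    (hinv : ∀ z : ℂ, ‖z‖ = 1 → IsUnit (∑' n : ℤ, z ^ n • f n)) :
    (∃ (ν : ℤ → ℝ) (g : ℤ → A), IsAMAW q ν ∧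
        (∃ K > (0 : ℝ), ∀ n, 1 ≤ ν n ∧ ν n ≤ K * ω n) ∧
        (Summable fun n : ℤ => ‖g n‖ ^ p * ν n ^ p) ∧
        (∀ n : ℤ, (∑' m : ℤ, f m * g (n - m)) = if n = 0 then 1 else 0) ∧
        (∀ n : ℤ, (∑' m : ℤ, g m * f (n - m)) = if n = 0 then 1 else 0)) ∧
      (IsAdmissible ω → ∃ g : ℤ → A,
        (Summable fun n : ℤ => ‖g n‖ ^ p * ω n ^ p) ∧
        (∀ n : ℤ, (∑' m : ℤ, f m * g (n - m)) = if n = 0 then 1 else 0) ∧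
        (∀ n : ℤ, (∑' m : ℤ, g m * f (n - m)) = if n = 0 then 1 else 0)) := by
  have hpq' : p.HolderConjugate q := by
    rw [Real.holderConjugate_iff]
    exact ⟨hp, by simpa [one_div] using hpq⟩
  have hq1 : 1 < q := hpq'.symm.lt
  have hq0 : 0 < q := by linarith
  obtain ⟨hw, hconv, hsum, hm1, hm2⟩ := hω
  have w1 := hw.1
  have wpos : ∀ n, 0 < ω n := fun n => zero_lt_one.trans_le (w1 n)
  have gpos : rho2 ω = 1 → ∀ r : ℝ, 1 < r → ∃ C : ℝ, 0 < C ∧ ∀ n : ℕ, ω n ≤ C * r ^ n := by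
    intro h
    refine growth_aux (fun n : ℕ => ω n) (fun n => w1 _) (fun m n => ?_) (rho2_one_aux hw h)
    have := hw.2 m n
    push_cast
    exact this
  have gneg : rho1 ω = 1 → ∀ r : ℝ, 1 < r → ∃ C : ℝ, 0 < C ∧
      ∀ n : ℕ, ω (-(n : ℤ)) ≤ C * r ^ n := by
    intro h
    refine growth_aux (fun n : ℕ => ω (-(n : ℤ))) (fun n => w1 _) (fun m n => ?_)
      (rho1_one_aux hw h)
    have := hw.2 (-(m : ℤ)) (-(n : ℤ))
    rw [← neg_add] at this
    push_cast
    exact this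
  have hadm : IsAdmissible ω → ∃ g : ℤ → A,
        (Summable fun n : ℤ => ‖g n‖ ^ p * ω n ^ p) ∧
        (∀ n : ℤ, (∑' m : ℤ, f m * g (n - m)) = if n = 0 then 1 else 0) ∧
        (∀ n : ℤ, (∑' m : ℤ, g m * f (n - m)) = if n = 0 then 1 else 0) := by
    rintro ⟨h1, h2⟩
    refine main_adm p q hpq' ω hw hconv hsum (fun r hr => ?_) f hf hinv
    obtain ⟨C₁, hC₁, h₁⟩ := gpos h2 r hr
    obtain ⟨C₂, hC₂, h₂⟩ := gneg h1 r hr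
    have hr0 : 0 < r := by linarith
    refine ⟨max C₁ C₂, fun n => ?_⟩
    have hpw : 0 ≤ r ^ n.natAbs := by positivity
    rcases Int.natAbs_eq n with h | h
    · have h3 := h₁ n.natAbs
      rw [← h] at h3
      exact h3.trans (mul_le_mul_of_nonneg_right (le_max_left _ _) hpw)
    · have h3 := h₂ n.natAbs
      rw [← h] at h3
      exact h3.trans (mul_le_mul_of_nonneg_right (le_max_right _ _) hpw)
  refine ⟨?_, hadm⟩
  by_cases h1 : rho1 ω = 1
  · by_cases h2 : rho2 ω = 1
    · obtain ⟨g, hg⟩ := hadm ⟨h1, h2⟩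
      exact ⟨ω, g, ⟨hw, hconv, hsum, hm1, hm2⟩,
        ⟨1, one_pos, fun n => ⟨w1 n, by rw [one_mul]⟩⟩, hg⟩
    · obtain ⟨K, hK, hKm⟩ := hm1 h1
      obtain ⟨r, hr, hrω⟩ := rho2_ne_aux hw h2
      obtain ⟨C, hC, hCr⟩ := gneg h1 r hr
      have hinj : Function.Injective (fun n : ℕ => -(n : ℤ)) := by
        intro a b h
        simpa using h
      refine finish_aux p q hpq' ω hw f hf hinv (fun n : ℕ => ω (-(n : ℤ))) (fun n => w1 _)
        (fun m n => ?_) (max (max 1 K) (ω 0)) 1 ((le_max_left _ _).trans (le_max_left _ _))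
        (fun n k => ?_) (hsum.comp_injective hinj)
        (fin_conv_aux q hq0 ω hw hconv hsum (fun n : ℕ => -(n : ℤ)) hinj (fun n k hk => ?_))
        (gneg h1) C 1 (fun n => ?_) (fun n => ?_)
      · have := hw.2 (-(m : ℤ)) (-(n : ℤ))
        rw [← neg_add] at this
        push_cast
        exact this
      · have hp1 := wpos (-((n + k : ℕ) : ℤ))
        have hp2 := w1 (-((n + k : ℕ) : ℤ))
        rcases Nat.eq_zero_or_pos n with rfl | hn
        · have e1 : ω (-((0 : ℕ) : ℤ)) = ω 0 := by simp
          rw [e1]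
          calc ω 0 ≤ ω 0 * ω (-((0 + k : ℕ) : ℤ)) := le_mul_of_one_le_right (wpos 0).le hp2
            _ ≤ _ := mul_le_mul_of_nonneg_right (le_max_right _ _) hp1.le
        · rcases Nat.eq_zero_or_pos k with rfl | hk
          · rw [add_zero]
            exact le_mul_of_one_le_left (wpos _).le ((le_max_left _ _).trans (le_max_left _ _))
          · have h3 := hKm (-(n : ℤ)) (-(k : ℤ)) (by omega) (by omega)
            rw [← neg_add, ← Nat.cast_add] at h3
            exact h3.trans (mul_le_mul_of_nonneg_right
              ((le_max_right _ _).trans (le_max_left _ _)) hp1.le)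
      · push_cast [hk]
        ring
      · exact (hCr n).trans (mul_le_mul_of_nonneg_left (hrω n) hC.le)
      · rw [one_mul]
  · obtain ⟨r, hr, hrω⟩ := rho1_ne_aux hw h1
    by_cases h2 : rho2 ω = 1
    · obtain ⟨K, hK, hKm⟩ := hm2 h2
      obtain ⟨C, hC, hCr⟩ := gpos h2 r hr
      have hinj : Function.Injective (fun n : ℕ => (n : ℤ)) := by
        intro a b h
        simpa using h
      refine finish_aux p q hpq' ω hw f hf hinv (fun n : ℕ => ω (n : ℤ)) (fun n => w1 _)
        (fun m n => ?_) (max 1 K) 1 (le_max_left _ _)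
        (fun n k => ?_) (hsum.comp_injective hinj)
        (fin_conv_aux q hq0 ω hw hconv hsum (fun n : ℕ => (n : ℤ)) hinj (fun n k hk => ?_))
        (gpos h2) 1 C (fun n => ?_) (fun n => ?_)
      · have := hw.2 (m : ℤ) (n : ℤ)
        push_cast
        exact this
      · have hp1 := wpos ((n + k : ℕ) : ℤ)
        have h3 := hKm (n : ℤ) (k : ℤ) (by omega) (by omega)
        rw [← Nat.cast_add] at h3
        exact h3.trans (mul_le_mul_of_nonneg_right (le_max_right _ _) hp1.le)
      · push_cast [hk]
        ring
      · rw [one_mul]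
      · exact (hCr n).trans (mul_le_mul_of_nonneg_left (hrω n) hC.le)
    · obtain ⟨s, hs, hsω⟩ := rho2_ne_aux hw h2
      obtain ⟨hps, D, hD⟩ := poly_aux q hq1
      have hu1 : ∀ n : ℕ, (1 : ℝ) ≤ ((n : ℝ) + 1) ^ 2 := by
        intro n
        have : (0 : ℝ) ≤ n := by positivity
        nlinarith
      have hum : ∀ m n : ℕ, (((m + n : ℕ) : ℝ) + 1) ^ 2 ≤ ((m : ℝ) + 1) ^ 2 * ((n : ℝ) + 1) ^ 2 := by
        intro m n
        have hm : (0 : ℝ) ≤ m := by positivity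
        have hn : (0 : ℝ) ≤ n := by positivity
        rw [← mul_pow]
        push_cast
        gcongr
        nlinarith [mul_nonneg hm hn]
      have hg := growth_aux (fun n : ℕ => ((n : ℝ) + 1) ^ 2) hu1 hum poly_growth
      obtain ⟨C₁, hC₁, h₁⟩ := hg s hs
      obtain ⟨C₂, hC₂, h₂⟩ := hg r hr
      refine finish_aux p q hpq' ω hw f hf hinv (fun n : ℕ => ((n : ℝ) + 1) ^ 2) hu1 hum 1 D le_rfl
        (fun n k => ?_) hps hD hg C₁ C₂ (fun n => ?_) (fun n => ?_)
      · rw [one_mul]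
        push_cast
        have hk : (0 : ℝ) ≤ k := by positivity
        gcongr
        linarith
      · exact (h₁ n).trans (mul_le_mul_of_nonneg_left (hsω n) hC₁.le)
      · exact (h₂ n).trans (mul_le_mul_of_nonneg_left (hrω n) hC₂.le)
end

section
/- Let 1 < p < ∞ with conjugate index q, and let ω be an almost monotone algebra weight on ℝ. (i) If ρ₂(ω) = 0, define ω̃ : ℝ → [1,∞) by ω̃(x) = sup{ω(h) : 0 ≤ h ≤ x} for x ≥ 0 and ω̃(x) = ω(x) for x < 0. (ii) If ρ₁(ω) = 0, define ω̃ : ℝ → [1,∞) by ω̃(x) = sup{ω(h) : x ≤ h ≤ 0} for x ≤ 0 and ω̃(x) = ω(x) for x > 0. In either case, ω̃ is an almost monotone algebra weight on ℝ and there is a constant K > 0 such that ω̃(x) ≤ K ω(x) for all x ∈ ℝ. -/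
open scoped BigOperators
open MeasureTheory

/-- A weight on `ℝ`: a Borel measurable `ω : ℝ → [1,∞)` with `ω(x+y) ≤ ω(x)ω(y)`. -/
def IsWeightR (ω : ℝ → ℝ) : Prop :=
  Measurable ω ∧ (∀ x, 1 ≤ ω x) ∧ ∀ x y, ω (x + y) ≤ ω x * ω y

/-- `ρ₁(ω) = sup{(log ω(x))/x : x < 0}`. -/
noncomputable def rho1R (ω : ℝ → ℝ) : ℝ :=
  sSup {r : ℝ | ∃ x : ℝ, x < 0 ∧ r = Real.log (ω x) / x}

/-- `ρ₂(ω) = inf{(log ω(x))/x : x > 0}`. -/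
noncomputable def rho2R (ω : ℝ → ℝ) : ℝ :=
  sInf {r : ℝ | ∃ x : ℝ, 0 < x ∧ r = Real.log (ω x) / x}

/-- A weight on `ℝ` is admissible if `ρ₁(ω) = ρ₂(ω) = 0`. -/
def IsAdmissibleR (ω : ℝ → ℝ) : Prop := rho1R ω = 0 ∧ rho2R ω = 0
/-- An almost monotone algebra weight on `ℝ` (for conjugate index `q`). -/
def IsAMAWR (q : ℝ) (ω : ℝ → ℝ) : Prop :=
  IsWeightR ω ∧
  (∀ x : ℝ, (∫ t : ℝ, ω t ^ (-q) * ω (x - t) ^ (-q)) ≤ ω x ^ (-q)) ∧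
  (Integrable fun x : ℝ => ω x ^ (-q)) ∧
  (rho1R ω = 0 → ∃ K > (0 : ℝ), ∀ x y : ℝ, x ≤ 0 → y ≤ 0 → ω x ≤ K * ω (x + y)) ∧
  (rho2R ω = 0 → ∃ K > (0 : ℝ), ∀ x y : ℝ, 0 ≤ x → 0 ≤ y → ω x ≤ K * ω (x + y))


lemma ii_of_bdd {f : ℝ → ℝ} (hf : Measurable f) (C : ℝ) (hC : ∀ x, |f x| ≤ C) (a b : ℝ) :
    IntervalIntegrable f volume a b := by
  rw [intervalIntegrable_iff]
  exact Measure.integrableOn_of_bounded (M := C) (by simp) hf.aestronglyMeasurable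
    (Filter.Eventually.of_forall hC)

lemma conv_int {f g : ℝ → ℝ} (hf : Integrable f) (hg : Measurable g) (h0 : ∀ x, 0 ≤ g x)
    (h1 : ∀ x, g x ≤ 1) (x : ℝ) : Integrable fun t => f t * g (x - t) := by
  refine hf.mul_bdd (c := 1) ?_ ?_
  · exact (hg.comp (measurable_const.sub measurable_id)).aestronglyMeasurable
  · refine Filter.Eventually.of_forall fun t => ?_
    rw [Real.norm_eq_abs, abs_of_nonneg (h0 _)]; exact h1 _

lemma decomp {w : ℝ → ℝ} (hw : Measurable w) (hi : Integrable w) (h0 : ∀ x, 0 ≤ w x)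
    (h1 : ∀ x, w x ≤ 1) (x : ℝ) (hx : 0 ≤ x) :
    ∫ t, w t * w (x - t) = 2 * (∫ t in Set.Iio 0, w t * w (x - t)) +
      ∫ t in (0:ℝ)..x, w t * w (x - t) := by
  have hI := conv_int hi hw h0 h1 x
  set f : ℝ → ℝ := fun t => w t * w (x - t) with hf
  have e1 := integral_add_compl (s := Set.Iio (0:ℝ)) measurableSet_Iio hI
  have e2 : ∫ t in (Set.Iio (0:ℝ))ᶜ, f t = (∫ t in Set.Icc 0 x, f t) + ∫ t in Set.Ioi x, f t := by
    rw [Set.compl_Iio, ← Set.Icc_union_Ioi_eq_Ici hx]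
    refine setIntegral_union ?_ measurableSet_Ioi hI.integrableOn hI.integrableOn
    rw [Set.disjoint_left]; intro t ht ht'
    exact absurd ht.2 (not_le.2 ht')
  have e3 : ∫ t in Set.Ioi x, f t = ∫ t in Set.Iio 0, f t := by
    rw [← integral_indicator measurableSet_Ioi, ← integral_indicator measurableSet_Iio,
      ← integral_sub_left_eq_self _ volume x]
    congr 1; ext t
    by_cases ht : t < 0
    · rw [Set.indicator_of_mem (show x - t ∈ Set.Ioi x by rw [Set.mem_Ioi]; linarith),
        Set.indicator_of_mem (show t ∈ Set.Iio 0 from ht)]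
      simp only [hf]; rw [sub_sub_cancel, mul_comm]
    · rw [Set.indicator_of_notMem (show x - t ∉ Set.Ioi x by rw [Set.mem_Ioi]; intro; linarith),
        Set.indicator_of_notMem (show t ∉ Set.Iio 0 from ht)]
  rw [intervalIntegral.integral_of_le hx, ← integral_Icc_eq_integral_Ioc]
  linarith

lemma kappa {w : ℝ → ℝ} (hw : Measurable w) (h0 : ∀ x, 0 ≤ w x)
    (h1 : ∀ x, w x ≤ 1) (m x : ℝ) :
    ∫ t in (0:ℝ)..x, w t * w (x - t) = (∫ t in (0:ℝ)..x, (w t - m) * (w (x - t) - m))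
      + 2 * m * (∫ t in (0:ℝ)..x, w t) - m ^ 2 * x := by
  have i1 : IntervalIntegrable w volume 0 x :=
    ii_of_bdd hw 1 (fun t => abs_le.2 ⟨by linarith [h0 t], h1 t⟩) _ _
  have i2 : IntervalIntegrable (fun t => w (x - t)) volume 0 x :=
    ii_of_bdd (by fun_prop) 1 (fun t => abs_le.2 ⟨by linarith [h0 (x-t)], h1 _⟩) _ _
  have i3 : IntervalIntegrable (fun t => w t * w (x - t)) volume 0 x := by
    refine ii_of_bdd (by fun_prop) 1 (fun t => ?_) _ _
    rw [abs_of_nonneg (mul_nonneg (h0 _) (h0 _))]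
    exact mul_le_one₀ (h1 _) (h0 _) (h1 _)
  have e : (fun t => (w t - m) * (w (x - t) - m)) =
    fun t => ((w t * w (x - t) - m * w t) - m * w (x - t)) + m ^ 2 := by ext t; ring
  have e' : ∫ t in (0:ℝ)..x, w (x - t) = ∫ t in (0:ℝ)..x, w t := by
    rw [intervalIntegral.integral_comp_sub_left]; simp
  rw [e, intervalIntegral.integral_add ((i3.sub (i1.const_mul m)).sub (i2.const_mul m))
    intervalIntegrable_const, intervalIntegral.integral_sub (i3.sub (i1.const_mul m))
    (i2.const_mul m), intervalIntegral.integral_sub i3 (i1.const_mul m),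
    intervalIntegral.integral_const_mul, intervalIntegral.integral_const_mul, e',
    intervalIntegral.integral_const, smul_eq_mul]
  ring

lemma conv_main {w : ℝ → ℝ} (hw : Measurable w) (hi : Integrable w) (h0 : ∀ x, 0 ≤ w x)
    (h1 : ∀ x, w x ≤ 1) (ha : ∀ a b, 0 ≤ a → a ≤ b → w b ≤ w a) (hhalf : ∫ t, w t ≤ 1 / 2)
    (h x m' : ℝ) (hh : 0 ≤ h) (hhx : h ≤ x) (hm' : w h ≤ m')
    (hF : ∫ t, w t * w (h - t) ≤ m') :
    ∫ t, w t * w (x - t) ≤ m' + 4 * x * (m' - w x) := by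
  have hx : 0 ≤ x := hh.trans hhx
  obtain ⟨m, hm⟩ : ∃ m, m = w x := ⟨_, rfl⟩
  have hm0 : 0 ≤ m := hm ▸ h0 x
  have hm1 : m ≤ 1 := hm ▸ h1 x
  have hmm : m ≤ m' := by rw [hm]; exact (ha h x hh hhx).trans hm'
  have hκ0 : ∀ t, 0 ≤ t → t ≤ x → 0 ≤ w t - m := fun t a b => by
    have := ha t x a b; linarith
  have hκ1 : ∀ t, w t - m ≤ 1 := fun t => by linarith [h1 t]
  have hκe : ∀ t, h ≤ t → w t - m ≤ m' - m := fun t a => by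
    have := ha h t hh a; linarith
  have iκ : ∀ (c d c' d' a b : ℝ), IntervalIntegrable
      (fun t => (w (c * t + d) - m) * (w (c' * t + d') - m)) volume a b := by
    intro c d c' d' a b
    refine ii_of_bdd (by fun_prop) 1 (fun t => ?_) _ _
    rw [abs_mul]
    refine mul_le_one₀ ?_ (abs_nonneg _) ?_ <;>
    · rw [abs_le]; constructor <;> linarith [h0 (c * t + d), h1 (c * t + d),
        h0 (c' * t + d'), h1 (c' * t + d')]
  have iκ' : ∀ y a b : ℝ, IntervalIntegrable
      (fun t => (w t - m) * (w (y - t) - m)) volume a b := by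
    intro y a b
    have := iκ 1 0 (-1) y a b
    convert this using 5 <;> ring
  have iw : ∀ a b, IntervalIntegrable w volume a b := fun a b => hi.intervalIntegrable
  -- mass
  have mass : ∀ y, 0 ≤ y → (∫ t in Set.Iio 0, w t) + ∫ t in (0:ℝ)..y, w t ≤ 1 / 2 := by
    intro y hy
    rw [intervalIntegral.integral_of_le hy, ← setIntegral_union _ measurableSet_Ioc
      hi.integrableOn hi.integrableOn]
    · exact (setIntegral_le_integral hi (Filter.Eventually.of_forall h0)).trans hhalf
    · rw [Set.disjoint_left]; intro t ht ht'
      exact absurd ht'.1 (not_lt.2 (le_of_lt ht))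
  have A1 : ∫ t in Set.Iio 0, w t * w (x - t) ≤ m * ∫ t in Set.Iio 0, w t := by
    rw [← integral_const_mul]
    refine setIntegral_mono_on (conv_int hi hw h0 h1 x).integrableOn
      (hi.const_mul m).integrableOn measurableSet_Iio fun t ht => ?_
    have ht : t < 0 := ht
    have := ha x (x - t) hx (by linarith)
    rw [mul_comm, hm]; exact mul_le_mul_of_nonneg_right this (h0 t)
  have A2 : ∫ t in Set.Iio 0, w t * w (x - t) ≤ ∫ t in Set.Iio 0, w t * w (h - t) := by
    refine setIntegral_mono_on (conv_int hi hw h0 h1 x).integrableOn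
      (conv_int hi hw h0 h1 h).integrableOn measurableSet_Iio fun t ht => ?_
    have ht : t < 0 := ht
    exact mul_le_mul_of_nonneg_left (ha _ _ (by linarith) (by linarith)) (h0 t)
  rw [decomp hw hi h0 h1 h hh, kappa hw h0 h1 m] at hF
  rw [decomp hw hi h0 h1 x hx, kappa hw h0 h1 m, ← hm]
  -- bound on pieces where one factor is small
  have small : ∀ a b, a ≤ b → 0 ≤ a → b ≤ x → (∀ t, a ≤ t → t ≤ b → h ≤ t ∨ h ≤ x - t) →
      ∫ t in a..b, (w t - m) * (w (x - t) - m) ≤ (b - a) * (m' - m) := by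
    intro a b hab ha0 hbx hor
    have : ∫ t in a..b, (m' - m) = (b - a) * (m' - m) := by
      rw [intervalIntegral.integral_const, smul_eq_mul]
    rw [← this]
    refine intervalIntegral.integral_mono_on hab (iκ' _ _ _) intervalIntegrable_const
      fun t ht => ?_
    have k1 := hκ0 t (ha0.trans ht.1) (ht.2.trans hbx)
    have k2 := hκ0 (x - t) (by linarith [ht.2]) (by linarith [ht.1])
    rcases hor t ht.1 ht.2 with g | g
    · have := hκe t g
      calc _ ≤ (w t - m) * 1 := mul_le_mul_of_nonneg_left (hκ1 _) k1
        _ ≤ _ := by linarith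
    · have := hκe _ g
      calc _ ≤ 1 * (w (x - t) - m) := mul_le_mul_of_nonneg_right (hκ1 _) k2
        _ ≤ _ := by linarith
  have hε : 0 ≤ m' - m := by linarith
  have hxε := mul_nonneg hx hε
  by_cases hd : x - h < h
  · -- stretch
    obtain ⟨d, hd'⟩ : ∃ d, d = x - h := ⟨_, rfl⟩
    have hxd : x = h + d := by linarith
    have hd0 : 0 ≤ d := by linarith
    have hdh : d < h := by linarith
    have hhpos : 0 < h := by linarith
    have s1 := small 0 d hd0 le_rfl (by linarith) (fun t _ _ => Or.inr (by linarith))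
    have s2 := small h x hhx hh le_rfl (fun t _ _ => Or.inl (by linarith))
    have split : ∫ t in (0:ℝ)..x, (w t - m) * (w (x - t) - m) =
        (∫ t in (0:ℝ)..d, (w t - m) * (w (x - t) - m)) +
        (∫ t in d..h, (w t - m) * (w (x - t) - m)) +
        (∫ t in h..x, (w t - m) * (w (x - t) - m)) := by
      rw [intervalIntegral.integral_add_adjacent_intervals (iκ' _ _ _) (iκ' _ _ _),
        intervalIntegral.integral_add_adjacent_intervals (iκ' _ _ _) (iκ' _ _ _)]
    have wsplit : ∫ t in (0:ℝ)..x, w t = (∫ t in (0:ℝ)..h, w t) + ∫ t in h..x, w t := by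
      rw [intervalIntegral.integral_add_adjacent_intervals (iw _ _) (iw _ _)]
    have wb : ∫ t in h..x, w t ≤ d * m' := by
      have : ∫ t in h..x, m' = d * m' := by simp [hd']
      rw [← this]
      refine intervalIntegral.integral_mono_on hhx (iw _ _) intervalIntegrable_const
        fun t ht => (ha h t hh ht.1).trans hm'
    obtain ⟨c, hc⟩ : ∃ c, c = (h - d) / h := ⟨_, rfl⟩
    have hch : c * h = h - d := by rw [hc]; field_simp
    have hc0 : 0 ≤ c := by rw [hc]; exact div_nonneg (by linarith) hh
    have hc1 : c ≤ 1 := by rw [hc, div_le_one hhpos]; linarith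
    have stretch : ∫ t in d..h, (w t - m) * (w (x - t) - m) ≤
        c * ∫ t in (0:ℝ)..h, (w t - m) * (w (h - t) - m) := by
      have := intervalIntegral.mul_integral_comp_mul_add (a := 0) (b := h)
        (f := fun t => (w t - m) * (w (x - t) - m)) c d
      rw [show c * 0 + d = d by ring, show c * h + d = h by linarith] at this
      rw [← this]
      refine mul_le_mul_of_nonneg_left ?_ hc0
      refine intervalIntegral.integral_mono_on hh ?_ (iκ' _ _ _) fun t ht => ?_
      · have := iκ c d (-c) (x - d) 0 h
        convert this using 5; ring
      · have q1 : t ≤ c * t + d := by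
          have : (1 - c) * t ≤ (1 - c) * h := mul_le_mul_of_nonneg_left ht.2 (by linarith)
          linarith
        have q2 : h - t ≤ x - (c * t + d) := by
          have : c * t ≤ 1 * t := mul_le_mul_of_nonneg_right hc1 ht.1
          linarith
        have q3 : 0 ≤ c * t := mul_nonneg hc0 ht.1
        refine mul_le_mul ?_ ?_ ?_ ?_
        · linarith [ha _ _ ht.1 q1]
        · linarith [ha _ _ (by linarith [ht.2]) q2]
        · exact hκ0 _ (by linarith [ht.2]) (by linarith)
        · exact hκ0 _ ht.1 (by linarith [ht.2])
    have dε : 0 ≤ d * (m' - m) := mul_nonneg hd0 hε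
    have hε' : 0 ≤ h * (m' - m) := mul_nonneg hh hε
    have mdε : m * (d * (m' - m)) ≤ d * (m' - m) := by
      have := mul_le_mul_of_nonneg_right hm1 dε; linarith
    have mwb : m * ∫ t in h..x, w t ≤ m * (d * m') := mul_le_mul_of_nonneg_left wb hm0
    rw [split, wsplit]
    have s2' : x - h = d := hd'.symm
    rw [s2'] at s2
    rw [sub_zero] at s1
    have mh := mul_le_mul_of_nonneg_left (mass h hh) hm0
    set k := ∫ t in (0:ℝ)..h, (w t - m) * (w (h - t) - m)
    have key : (∫ t in d..h, (w t - m) * (w (x - t) - m)) - m ^ 2 * (h - d) ≤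
        c * (k - m ^ 2 * h) := by
      rw [← hch]; linarith
    by_cases hk : k - m ^ 2 * h ≤ 0
    · have : c * (k - m ^ 2 * h) ≤ 0 := mul_nonpos_of_nonneg_of_nonpos hc0 hk
      subst hxd
      linarith
    · have : c * (k - m ^ 2 * h) ≤ 1 * (k - m ^ 2 * h) :=
        mul_le_mul_of_nonneg_right hc1 (by linarith)
      subst hxd
      linarith
  · have s := small 0 x hx le_rfl le_rfl (fun t _ _ => by
      by_cases g : h ≤ t
      · exact Or.inl g
      · exact Or.inr (by linarith))
    have mx := mul_le_mul_of_nonneg_left (mass x hx) hm0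
    have : 0 ≤ m ^ 2 * x := by positivity
    rw [sub_zero] at s
    linarith

lemma half {u : ℝ → ℝ} (hu : Measurable u) (hi : Integrable u) (h0 : ∀ x, 0 ≤ u x)
    (h1 : ∀ x, u x ≤ 1) (hc : ∀ x, ∫ t, u t * u (x - t) ≤ u x)
    (hs : ∀ s > 0, ∃ c > 0, ∀ x, 0 ≤ x → c * Real.exp (-(s * x)) ≤ u x) :
    ∫ t, u t ≤ 1 / 2 := by
  by_contra hcon
  push Not at hcon
  have ht := intervalIntegral_tendsto_integral (μ := volume) (f := u) hi
    Filter.tendsto_neg_atTop_atBot Filter.tendsto_id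
  obtain ⟨T, hT, hT0⟩ := ((ht.eventually_const_lt hcon).and (Filter.eventually_gt_atTop 0)).exists
  simp only [id] at hT
  rw [intervalIntegral.integral_of_le (by linarith)] at hT
  set J := ∫ t in Set.Ioc (-T) T, u t with hJ
  -- choose s
  obtain ⟨s, hs0, hsT⟩ : ∃ s > 0, 1 < 2 * J * Real.exp (-(s * T)) := by
    refine ⟨Real.log (2 * J) / (2 * T), div_pos (Real.log_pos (by linarith)) (by linarith), ?_⟩
    have : Real.log (2 * J) / (2 * T) * T = Real.log (2 * J) / 2 := by field_simp
    rw [this]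
    nth_rewrite 1 [← Real.exp_log (show 0 < 2 * J by linarith)]
    rw [← Real.exp_add, Real.one_lt_exp_iff]
    have := Real.log_pos (show 1 < 2 * J by linarith)
    linarith
  obtain ⟨c, hc0, hcs⟩ := hs s hs0
  set B := Real.exp (s * (3 * T)) * T with hB
  -- for each N
  have main : ∀ N, 3 * T ≤ N → (2 * J * Real.exp (-(s * T)) - 1) * (c * (N - 3 * T)) ≤ B := by
    intro N hN
    set φ : ℝ → ℝ := fun x => Real.exp (s * min x N) with hφ
    have φm : Measurable φ := by fun_prop
    have φ0 : ∀ x, 0 < φ x := fun x => Real.exp_pos _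
    have φb : ∀ x, φ x ≤ Real.exp (s * N) := fun x =>
      Real.exp_le_exp.2 (mul_le_mul_of_nonneg_left (min_le_right _ _) hs0.le)
    have φs : ∀ x t, t ≤ T → -T ≤ t → Real.exp (-(s * T)) * φ (x - t) ≤ φ x := by
      intro x t h h'
      simp only [hφ]
      rw [← Real.exp_add, Real.exp_le_exp]
      have : min (x - t) N ≤ min x N + T := by
        rcases le_total x N with g | g
        · rw [min_eq_left g]; exact (min_le_left _ _).trans (by linarith)
        · rw [min_eq_right g]; exact (min_le_right _ _).trans (by linarith)
      have := mul_le_mul_of_nonneg_left this hs0.le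
      linarith
    have iφ : Integrable fun x => u x * φ x := by
      refine hi.mul_bdd (c := Real.exp (s * N)) φm.aestronglyMeasurable
        (Filter.Eventually.of_forall fun x => ?_)
      rw [Real.norm_eq_abs, abs_of_pos (φ0 x)]; exact φb x
    set U : ℝ → ℝ := (Set.Ioc (-T) T).indicator u with hU
    set V : ℝ → ℝ := (Set.Ioi (3 * T)).indicator u with hV
    set W : ℝ → ℝ := (Set.Ioi (3 * T)).indicator (fun x => u x * φ x) with hW
    have Ui : Integrable U := hi.indicator measurableSet_Ioc
    have Vi : Integrable V := hi.indicator measurableSet_Ioi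
    have Wi : Integrable W := iφ.indicator measurableSet_Ioi
    have Um : Measurable U := hu.indicator measurableSet_Ioc
    have Vm : Measurable V := hu.indicator measurableSet_Ioi
    have U0 : ∀ x, 0 ≤ U x := fun x => Set.indicator_nonneg (fun _ _ => h0 _) x
    have V0 : ∀ x, 0 ≤ V x := fun x => Set.indicator_nonneg (fun _ _ => h0 _) x
    have U1 : ∀ x, U x ≤ u x := fun x => Set.indicator_le_self' (fun _ _ => h0 _) x
    have V1 : ∀ x, V x ≤ u x := fun x => Set.indicator_le_self' (fun _ _ => h0 _) x
    have WV : ∀ x, W x = V x * φ x := by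
      intro x
      by_cases hx : x ∈ Set.Ioi (3 * T)
      · simp [hW, hV, Set.indicator_of_mem hx]
      · simp [hW, hV, Set.indicator_of_notMem hx]
    have UVi : ∀ x, Integrable fun t => U t * V (x - t) := fun x =>
      conv_int Ui Vm V0 (fun x => (V1 x).trans (h1 x)) x
    have VUi : ∀ x, Integrable fun t => V t * U (x - t) := fun x =>
      conv_int Vi Um U0 (fun x => (U1 x).trans (h1 x)) x
    have two : ∀ x, 2 * ∫ t, U t * V (x - t) ≤ u x := by
      intro x
      have e : ∫ t, V t * U (x - t) = ∫ t, U t * V (x - t) := by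
        rw [← integral_sub_left_eq_self _ volume x]
        congr 1; ext t; rw [sub_sub_cancel, mul_comm]
      have : ∫ t, (U t * V (x - t) + V t * U (x - t)) ≤ ∫ t, u t * u (x - t) := by
        refine integral_mono ((UVi x).add (VUi x)) (conv_int hi hu h0 h1 x) fun t => ?_
        show U t * V (x - t) + V t * U (x - t) ≤ u t * u (x - t)
        by_cases g : t ∈ Set.Ioc (-T) T
        · have : V t = 0 := Set.indicator_of_notMem (by
            simp only [Set.mem_Ioi, not_lt]; linarith [g.2]) _
          rw [this, zero_mul, add_zero]
          exact mul_le_mul (U1 _) (V1 _) (V0 _) (h0 _)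
        · have : U t = 0 := Set.indicator_of_notMem g _
          rw [this, zero_mul, zero_add]
          exact mul_le_mul (V1 _) (U1 _) (U0 _) (h0 _)
      rw [integral_add (UVi x) (VUi x), e] at this
      linarith [hc x]
    have zer : ∀ x, x ≤ 2 * T → ∀ t, U t * W (x - t) = 0 := by
      intro x hx t
      by_cases g : t ∈ Set.Ioc (-T) T
      · have : W (x - t) = 0 := Set.indicator_of_notMem (by
            simp only [Set.mem_Ioi, not_lt]; linarith [g.1]) _
        rw [this, mul_zero]
      · have : U t = 0 := Set.indicator_of_notMem g _
        rw [this, zero_mul]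
    set L := ContinuousLinearMap.mul ℝ ℝ
    have cv : ∀ x, convolution U W L volume x = ∫ t, U t * W (x - t) := fun x => rfl
    have cvi : Integrable (convolution U W L volume) := Ui.integrable_convolution L Wi
    have UWi : ∀ x, Integrable fun t => U t * W (x - t) := by
      intro x
      have e : (fun t => U t * W (x - t)) = fun t => (U t * V (x - t)) * φ (x - t) := by
        ext t; rw [WV]; ring
      rw [e]
      refine (UVi x).mul_bdd (c := Real.exp (s * N))
        (φm.comp (measurable_const.sub measurable_id)).aestronglyMeasurable
        (Filter.Eventually.of_forall fun t => ?_)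
      rw [Real.norm_eq_abs, abs_of_pos (φ0 _)]; exact φb _
    have pw : ∀ x, 2 * Real.exp (-(s * T)) * convolution U W L volume x ≤
        (Set.Ioi (2 * T)).indicator (fun x => u x * φ x) x := by
      intro x
      rw [cv]
      by_cases hx : x ≤ 2 * T
      · simp only [zer x hx, integral_zero, mul_zero]
        exact Set.indicator_nonneg (fun _ _ => mul_nonneg (h0 _) (φ0 _).le) x
      · rw [Set.indicator_of_mem (by simpa using hx)]
        have : Real.exp (-(s * T)) * ∫ t, U t * W (x - t) ≤ φ x * ∫ t, U t * V (x - t) := by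
          rw [← integral_const_mul, ← integral_const_mul]
          refine integral_mono ((UWi x).const_mul _) ((UVi x).const_mul _) fun t => ?_
          show Real.exp (-(s * T)) * (U t * W (x - t)) ≤ φ x * (U t * V (x - t))
          by_cases g : t ∈ Set.Ioc (-T) T
          · have := mul_le_mul_of_nonneg_right (φs x t g.2 g.1.le)
              (mul_nonneg (U0 t) (V0 (x - t)))
            rw [WV]; linarith
          · have : U t = 0 := Set.indicator_of_notMem g _
            simp [this]
        have := mul_le_mul_of_nonneg_right (two x) (φ0 x).le
        linarith
    have fin := integral_mono (cvi.const_mul (2 * Real.exp (-(s * T))))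
      (iφ.indicator (s := Set.Ioi (2 * T)) measurableSet_Ioi) pw
    have ic : ∫ x, convolution U W L volume x = (∫ x, U x) * ∫ x, W x := by
      rw [integral_convolution L Ui Wi]; rfl
    rw [integral_const_mul, ic, hU, integral_indicator measurableSet_Ioc, ← hJ,
      integral_indicator measurableSet_Ioi, integral_indicator measurableSet_Ioi,
      ← Set.Ioc_union_Ioi_eq_Ioi (show 2 * T ≤ 3 * T by linarith),
      setIntegral_union (Set.Ioc_disjoint_Ioi le_rfl) measurableSet_Ioi iφ.integrableOn
        iφ.integrableOn] at fin
    have b1 : ∫ x in Set.Ioc (2 * T) (3 * T), u x * φ x ≤ B := by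
      have : ∫ x in Set.Ioc (2 * T) (3 * T), Real.exp (s * (3 * T)) = B := by
        rw [← intervalIntegral.integral_of_le (by linarith)]
        simp [hB]; ring
      rw [← this]
      refine setIntegral_mono_on iφ.integrableOn (by simp) measurableSet_Ioc fun x hx => ?_
      have : φ x ≤ Real.exp (s * (3 * T)) := Real.exp_le_exp.2
        (mul_le_mul_of_nonneg_left ((min_le_left _ _).trans hx.2) hs0.le)
      calc u x * φ x ≤ 1 * φ x := mul_le_mul_of_nonneg_right (h1 x) (φ0 x).le
        _ ≤ _ := by linarith
    have b2 : c * (N - 3 * T) ≤ ∫ x in Set.Ioi (3 * T), u x * φ x := by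
      have : ∫ x in Set.Ioc (3 * T) N, c = c * (N - 3 * T) := by
        rw [← intervalIntegral.integral_of_le hN]
        simp; ring
      rw [← this]
      refine le_trans ?_ (setIntegral_mono_set (s := Set.Ioc (3 * T) N) iφ.integrableOn
        (Filter.Eventually.of_forall fun x => mul_nonneg (h0 _) (φ0 _).le)
        (Filter.Eventually.of_forall fun x hx => hx.1))
      refine setIntegral_mono_on (by simp) iφ.integrableOn measurableSet_Ioc fun x hx => ?_
      have := hcs x (by linarith [hx.1])
      have e : φ x = Real.exp (s * x) := by simp only [hφ]; rw [min_eq_left hx.2]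
      rw [e]
      have := mul_le_mul_of_nonneg_right this (Real.exp_pos (s * x)).le
      rwa [mul_assoc, ← Real.exp_add, neg_add_cancel, Real.exp_zero, mul_one] at this
    have := mul_le_mul_of_nonneg_left b2 (show 0 ≤ 2 * J * Real.exp (-(s * T)) - 1 by linarith)
    linarith
  set δ := (2 * J * Real.exp (-(s * T)) - 1) * c with hδ
  have hδ0 : 0 < δ := mul_pos (by linarith) hc0
  have B0 : 0 ≤ B := by positivity
  have := main (3 * T + (B + 1) / δ) (by have : 0 ≤ (B+1)/δ := by positivity
                                         linarith)
  rw [add_sub_cancel_left, ← mul_assoc, ← hδ, mul_div_cancel₀ _ hδ0.ne'] at this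
  linarith

lemma growth {ω : ℝ → ℝ} (hω : IsWeightR ω) (hr : rho2R ω = 0)
    (hb : ∀ x, 0 ≤ x → ∃ B, ∀ h, 0 ≤ h → h ≤ x → ω h ≤ B) (ε : ℝ) (hε : 0 < ε) :
    ∃ C > 0, ∀ x, 0 ≤ x → ω x ≤ C * Real.exp (ε * x) := by
  obtain ⟨-, h1, hsub⟩ := hω
  have hpos : ∀ x, 0 < ω x := fun x => by linarith [h1 x]
  obtain ⟨r, ⟨a, ha, rfl⟩, hlt⟩ := exists_lt_of_csInf_lt
    (s := {r : ℝ | ∃ x : ℝ, 0 < x ∧ r = Real.log (ω x) / x}) ⟨_, 1, one_pos, rfl⟩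
    (show sInf _ < ε by unfold rho2R at hr; rw [hr]; exact hε)
  have hωa : ω a ≤ Real.exp (ε * a) := by
    rw [← Real.log_le_iff_le_exp (hpos a)]
    exact ((div_lt_iff₀ ha).1 hlt).le
  obtain ⟨B, hB⟩ := hb a ha.le
  have B1 : 1 ≤ B := (h1 0).trans (hB 0 le_rfl ha.le)
  refine ⟨B, by linarith, fun x hx => ?_⟩
  have ind : ∀ (n : ℕ) (r : ℝ), ω (n * a + r) ≤ Real.exp (ε * (n * a)) * ω r := by
    intro n r
    induction n with
    | zero => simp
    | succ n ih =>
      have e : ((n + 1 : ℕ) : ℝ) * a + r = a + (n * a + r) := by push_cast; ring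
      have e' : Real.exp (ε * (((n + 1 : ℕ) : ℝ) * a)) =
          Real.exp (ε * a) * Real.exp (ε * (n * a)) := by
        rw [← Real.exp_add]; congr 1; push_cast; ring
      rw [e, e', mul_assoc]
      exact (hsub _ _).trans (mul_le_mul hωa ih (hpos _).le (Real.exp_pos _).le)
  set n := ⌊x / a⌋₊
  have n1 : n * a ≤ x := (le_div_iff₀ ha).1 (Nat.floor_le (by positivity))
  have n2 : x < (n + 1) * a := (div_lt_iff₀ ha).1 (Nat.lt_floor_add_one _)
  have := ind n (x - n * a)
  rw [add_sub_cancel] at this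
  refine this.trans ?_
  rw [mul_comm]
  refine mul_le_mul (hB _ (by linarith) (by linarith)) ?_ (Real.exp_pos _).le (by linarith)
  exact Real.exp_le_exp.2 (mul_le_mul_of_nonneg_left n1 hε.le)

lemma part1 (q : ℝ) (hq : 0 < q) (ω : ℝ → ℝ) (hω : IsAMAWR q ω) (hr : rho2R ω = 0)
    (ωt : ℝ → ℝ)
    (hl : ∀ x : ℝ, 0 ≤ x → IsLUB {y : ℝ | ∃ h : ℝ, 0 ≤ h ∧ h ≤ x ∧ y = ω h} (ωt x))
    (hn : ∀ x : ℝ, x < 0 → ωt x = ω x) :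
    IsAMAWR q ωt ∧ ∃ K > (0 : ℝ), ∀ x : ℝ, ωt x ≤ K * ω x := by
  obtain ⟨hW, hconv, hint, hr1, hr2⟩ := hω
  have hW' := hW
  obtain ⟨hm, h1, hsub⟩ := hW
  have hpos : ∀ x, 0 < ω x := fun x => by linarith [h1 x]
  have le : ∀ h x, 0 ≤ h → h ≤ x → ω h ≤ ωt x := fun h x a b =>
    (hl x (a.trans b)).1 ⟨h, a, b, rfl⟩
  have lub : ∀ x C, 0 ≤ x → (∀ h, 0 ≤ h → h ≤ x → ω h ≤ C) → ωt x ≤ C := by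
    intro x C hx h
    refine (hl x hx).2 ?_
    rintro _ ⟨y, a, b, rfl⟩; exact h y a b
  have hge : ∀ x, ω x ≤ ωt x := fun x => by
    rcases lt_or_ge x 0 with g | g
    · rw [hn x g]
    · exact le x x g le_rfl
  have ht1 : ∀ x, 1 ≤ ωt x := fun x => (h1 x).trans (hge x)
  have htpos : ∀ x, 0 < ωt x := fun x => by linarith [ht1 x]
  have mono : ∀ a b, 0 ≤ a → a ≤ b → ωt a ≤ ωt b := fun a b h g =>
    lub a _ h fun y y0 ya => le y b y0 (ya.trans g)
  have ht0 : ωt 0 = ω 0 := le_antisymm (lub 0 _ le_rfl fun h a b => by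
    rw [le_antisymm b a]) (hge 0)
  have hnp : ∀ x, x ≤ 0 → ωt x = ω x := fun x hx => by
    rcases hx.lt_or_eq with g | g
    · exact hn x g
    · rw [g, ht0]
  have mt : Measurable ωt := by
    have g1 : Monotone fun x => ωt (max x 0) := fun a b hab =>
      mono _ _ (le_max_right _ _) (max_le_max_right 0 hab)
    have : ωt = fun x => if x < 0 then ω x else ωt (max x 0) := by
      ext x
      split_ifs with h
      · exact hn x h
      · rw [max_eq_left (not_lt.1 h)]
    rw [this]
    exact Measurable.ite measurableSet_Iio hm g1.measurable
  have mixed : ∀ x y, 0 ≤ x → y < 0 → ωt (x + y) ≤ ωt x * ωt y := by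
    intro x y hx hy
    rcases lt_or_ge (x + y) 0 with g | g
    · rw [hn _ g, hn _ hy]
      exact (hsub x y).trans (mul_le_mul_of_nonneg_right (hge x) (hpos y).le)
    · exact (mono _ x g (by linarith)).trans (le_mul_of_one_le_right (htpos x).le (ht1 y))
  have subt : ∀ x y, ωt (x + y) ≤ ωt x * ωt y := by
    intro x y
    rcases lt_or_ge x 0 with hx | hx <;> rcases lt_or_ge y 0 with hy | hy
    · rw [hn _ hx, hn _ hy, hn _ (by linarith)]; exact hsub x y
    · rw [add_comm, mul_comm]; exact mixed y x hy hx
    · exact mixed x y hx hy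
    · refine lub _ _ (by linarith) fun h h0 hxy => ?_
      have e : h = min h x + (h - min h x) := by ring
      rw [e]
      refine (hsub _ _).trans (mul_le_mul (le _ _ (le_min h0 hx) (min_le_right _ _))
        (le _ _ (by linarith [min_le_left h x]) ?_) (hpos _).le (htpos _).le)
      rcases le_total h x with g | g
      · rw [min_eq_left g]; linarith
      · rw [min_eq_right g]; linarith
  -- powers
  set u : ℝ → ℝ := fun x => ω x ^ (-q) with hu
  set w : ℝ → ℝ := fun x => ωt x ^ (-q) with hw
  have anti : ∀ a b : ℝ, 0 < a → a ≤ b → b ^ (-q) ≤ a ^ (-q) := fun a b ha hab =>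
    Real.rpow_le_rpow_of_nonpos ha hab (by linarith)
  have um : Measurable u := hm.pow_const _
  have wm : Measurable w := mt.pow_const _
  have u0 : ∀ x, 0 ≤ u x := fun x => Real.rpow_nonneg (hpos x).le _
  have w0 : ∀ x, 0 ≤ w x := fun x => Real.rpow_nonneg (htpos x).le _
  have wu : ∀ x, w x ≤ u x := fun x => anti _ _ (hpos x) (hge x)
  have u1 : ∀ x, u x ≤ 1 := fun x => by
    have := anti 1 (ω x) one_pos (h1 x); rwa [Real.one_rpow] at this
  have w1 : ∀ x, w x ≤ 1 := fun x => (wu x).trans (u1 x)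
  have wi : Integrable w := hint.mono' wm.aestronglyMeasurable
    (Filter.Eventually.of_forall fun x => by
      rw [Real.norm_eq_abs, abs_of_nonneg (w0 x)]; exact wu x)
  have uhalf : ∫ t, u t ≤ 1 / 2 := by
    refine half um hint u0 u1 hconv fun s hs => ?_
    obtain ⟨C, hC, hg⟩ := growth hW' hr (fun x hx => ⟨ωt x, fun h a b => le h x a b⟩)
      (s / q) (by positivity)
    refine ⟨C ^ (-q), by positivity, fun x hx => ?_⟩
    have := anti _ _ (hpos x) (hg x hx)
    rw [Real.mul_rpow hC.le (Real.exp_pos _).le, ← Real.exp_mul] at this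
    have e : s / q * x * -q = -(s * x) := by field_simp
    rwa [e] at this
  have whalf : ∫ t, w t ≤ 1 / 2 := (integral_mono wi hint wu).trans uhalf
  have ww : ∀ x, ∫ t, w t * w (x - t) ≤ u x := fun x => by
    refine le_trans (integral_mono (conv_int wi wm w0 w1 x) (conv_int hint um u0 u1 x)
      fun t => ?_) (hconv x)
    exact mul_le_mul (wu _) (wu _) (w0 _) (u0 _)
  have wconv : ∀ x, ∫ t, w t * w (x - t) ≤ w x := by
    intro x
    rcases lt_or_ge x 0 with hx | hx
    · have : w x = u x := by simp only [hw, hu]; rw [hn x hx]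
      rw [this]; exact ww x
    · have wa : ∀ a b, 0 ≤ a → a ≤ b → w b ≤ w a := fun a b h g =>
        anti _ _ (htpos a) (mono a b h g)
      have key : ∀ h, 0 ≤ h → h ≤ x →
          ∫ t, w t * w (x - t) ≤ u h + 4 * x * (u h - w x) := fun h a b =>
        conv_main wm wi w0 w1 wa whalf h x (u h) a b (wu h) (ww h)
      have cl := (hl x hx).mem_closure ⟨_, 0, le_rfl, hx, rfl⟩
      obtain ⟨y, hy, hlim⟩ := mem_closure_iff_seq_limit.1 cl
      have l1 : Filter.Tendsto (fun n => y n ^ (-q)) Filter.atTop (nhds (w x)) :=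
        hlim.rpow_const (Or.inl (htpos x).ne')
      have l2 := l1.add ((l1.sub_const (w x)).const_mul (4 * x))
      rw [sub_self, mul_zero, add_zero] at l2
      refine ge_of_tendsto' l2 fun n => ?_
      obtain ⟨h, a, b, e⟩ := hy n
      rw [e]; exact key h a b
  refine ⟨⟨⟨mt, ht1, subt⟩, wconv, wi, ?_, ?_⟩, ?_⟩
  · intro h
    have e : rho1R ωt = rho1R ω := by
      unfold rho1R; congr 1; ext r
      constructor <;> rintro ⟨x, hx, e⟩ <;> refine ⟨x, hx, ?_⟩ <;> rw [e, hn x hx]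
    obtain ⟨K, hK, H⟩ := hr1 (e ▸ h)
    refine ⟨K, hK, fun x y hx hy => ?_⟩
    rw [hnp x hx, hnp _ (by linarith)]; exact H x y hx hy
  · intro _
    refine ⟨1, one_pos, fun x y hx hy => ?_⟩
    rw [one_mul]; exact mono _ _ hx (by linarith)
  · obtain ⟨K, hK, H⟩ := hr2 hr
    refine ⟨max K 1, by positivity, fun x => ?_⟩
    rcases lt_or_ge x 0 with hx | hx
    · rw [hn x hx]
      exact le_mul_of_one_le_left (hpos x).le (le_max_right _ _)
    · refine lub x _ hx fun h a b => ?_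
      have := H h (x - h) a (by linarith)
      rw [add_sub_cancel] at this
      exact this.trans (mul_le_mul_of_nonneg_right (le_max_left _ _) (hpos x).le)

lemma rho2_neg (ω : ℝ → ℝ) : rho2R (fun x => ω (-x)) = - rho1R ω := by
  unfold rho1R rho2R
  rw [← Real.sInf_neg]
  congr 1; ext r
  simp only [Set.mem_neg, Set.mem_ofPred_eq]
  constructor
  · rintro ⟨x, hx, e⟩
    exact ⟨-x, by linarith, by rw [e, div_neg]⟩
  · rintro ⟨x, hx, e⟩
    exact ⟨-x, by linarith, by rw [neg_neg, div_neg, ← e, neg_neg]⟩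

lemma rho1_neg (ω : ℝ → ℝ) : rho1R (fun x => ω (-x)) = - rho2R ω := by
  have := rho2_neg (fun x => ω (-x))
  simp only [neg_neg] at this
  rw [this, neg_neg]

lemma amaw_neg {q : ℝ} {ω : ℝ → ℝ} (h : IsAMAWR q ω) : IsAMAWR q (fun x => ω (-x)) := by
  obtain ⟨⟨hm, h1, hsub⟩, hconv, hint, hr1, hr2⟩ := h
  refine ⟨⟨hm.comp measurable_neg, fun x => h1 _, fun x y => ?_⟩, fun x => ?_, hint.comp_neg,
    fun h => ?_, fun h => ?_⟩
  · show ω (-(x + y)) ≤ _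
    rw [neg_add]; exact hsub _ _
  · have := hconv (-x)
    rw [← integral_neg_eq_self] at this
    refine le_trans (le_of_eq ?_) this
    congr 1; ext t
    show ω (-t) ^ (-q) * ω (-(x - t)) ^ (-q) = _
    rw [show -(x - t) = -x - -t by ring]
  · rw [rho1_neg, neg_eq_zero] at h
    obtain ⟨K, hK, H⟩ := hr2 h
    refine ⟨K, hK, fun x y hx hy => ?_⟩
    have := H (-x) (-y) (by linarith) (by linarith)
    rwa [← neg_add] at this
  · rw [rho2_neg, neg_eq_zero] at h
    obtain ⟨K, hK, H⟩ := hr1 h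
    refine ⟨K, hK, fun x y hx hy => ?_⟩
    have := H (-x) (-y) (by linarith) (by linarith)
    rwa [← neg_add] at this

/-- **Lemma 5.3.** Let `ω` be an almost monotone algebra weight on `ℝ`.
(i) If `ρ₂(ω) = 0` and `ω̃(x) = sup{ω(h) : 0 ≤ h ≤ x}` for `x ≥ 0`, `ω̃(x) = ω(x)` for
`x < 0`, then `ω̃` is an almost monotone algebra weight and `ω̃ ≤ K ω` for some `K > 0`.
(ii) If `ρ₁(ω) = 0` and `ω̃(x) = sup{ω(h) : x ≤ h ≤ 0}` for `x ≤ 0`, `ω̃(x) = ω(x)` for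
`x > 0`, likewise. -/
theorem stmt16 (p q : ℝ) (hp : 1 < p) (hpq : 1 / p + 1 / q = 1)
    (ω : ℝ → ℝ) (hω : IsAMAWR q ω) :
    (rho2R ω = 0 → ∀ ωt : ℝ → ℝ,
      (∀ x : ℝ, 0 ≤ x → IsLUB {y : ℝ | ∃ h : ℝ, 0 ≤ h ∧ h ≤ x ∧ y = ω h} (ωt x)) →
      (∀ x : ℝ, x < 0 → ωt x = ω x) →
      IsAMAWR q ωt ∧ ∃ K > (0 : ℝ), ∀ x : ℝ, ωt x ≤ K * ω x) ∧
    (rho1R ω = 0 → ∀ ωt : ℝ → ℝ,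
      (∀ x : ℝ, x ≤ 0 → IsLUB {y : ℝ | ∃ h : ℝ, x ≤ h ∧ h ≤ 0 ∧ y = ω h} (ωt x)) →
      (∀ x : ℝ, 0 < x → ωt x = ω x) →
      IsAMAWR q ωt ∧ ∃ K > (0 : ℝ), ∀ x : ℝ, ωt x ≤ K * ω x) := by
  have hq : 0 < q := by
    have hp' : 1 / p < 1 := by rw [div_lt_one (by linarith)]; exact hp
    exact one_div_pos.1 (by linarith)
  refine ⟨fun hr ωt hl hn => part1 q hq ω hω hr ωt hl hn, fun hr ωt hl hn => ?_⟩
  obtain ⟨H, K, hK, HK⟩ := part1 q hq (fun x => ω (-x)) (amaw_neg hω)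
    (by rw [rho2_neg, hr, neg_zero]) (fun x => ωt (-x))
    (fun x hx => by
      convert hl (-x) (by linarith) using 1
      ext y
      constructor
      · rintro ⟨h, a, b, e⟩; exact ⟨-h, by linarith, by linarith, e⟩
      · rintro ⟨h, a, b, e⟩
        exact ⟨-h, by linarith, by linarith, by rw [e, neg_neg]⟩)
    (fun x hx => hn (-x) (by linarith))
  refine ⟨?_, K, hK, fun x => ?_⟩
  · have := amaw_neg H
    simpa only [neg_neg] using this
  · have := HK (-x)
    simpa only [neg_neg] using this
end
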